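/- arXiv:math/0203286 — 2 statements merged into one kernel-verified Lean document; each statement's English description precedes it below -/
import Mathlib

section
/- For a > 0 and γ > 0, ∫_{ℝ^N} e^{-a|u|²} ∏_{1≤i<j≤N} |u_j - u_i|^{2γ} du = (2π)^{N/2} (2a)^{-N(γ(N-1)+1)/2} ∏_{i=1}^N Γ(1+iγ)/Γ(1+γ). -/
open Finset Real MeasureTheory

/-- The absolute value of the Vandermonde determinant of `x`. -/
noncomputable def absVandermonde {n : ℕ} (x : Fin n → ℝ) : ℝ := ∏ i, ∏ j ∈ Ioi i, |x j - x i|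

/-- The `n` points `y` strictly interlace the `n + 1` points `x`. -/
def Interlaces {n : ℕ} (y : Fin n → ℝ) (x : Fin (n + 1) → ℝ) : Prop :=
  ∀ i, x i.castSucc < y i ∧ y i < x i.succ

lemma Interlaces.strictMono_right {n : ℕ} {y : Fin n → ℝ} {x : Fin (n + 1) → ℝ}
    (h : Interlaces y x) : StrictMono x :=
  Fin.strictMono_iff_lt_succ.2 fun i => (h i).1.trans (h i).2

lemma Interlaces.strictMono_left {n : ℕ} {y : Fin n → ℝ} {x : Fin (n + 1) → ℝ}
    (h : Interlaces y x) : StrictMono y := by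
  cases n with
  | zero => exact fun i => i.elim0
  | succ n => exact Fin.strictMono_iff_lt_succ.2 fun i => (h _).2.trans (h i.succ).1

lemma absVandermonde_nonneg {n : ℕ} (x : Fin n → ℝ) : 0 ≤ absVandermonde x :=
  prod_nonneg fun _ _ => prod_nonneg fun _ _ => abs_nonneg _

lemma absVandermonde_pos {n : ℕ} {x : Fin n → ℝ} (hx : Function.Injective x) :
    0 < absVandermonde x :=
  prod_pos fun _ _ => prod_pos fun _ hj =>
    abs_pos.2 (sub_ne_zero.2 (hx.ne (mem_Ioi.1 hj).ne'))

lemma abs_det_vandermonde {n : ℕ} (x : Fin n → ℝ) :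
    |(Matrix.vandermonde x).det| = absVandermonde x := by
  simp [Matrix.det_vandermonde, absVandermonde, abs_prod]

lemma prod_prod_erase_abs_sub {n : ℕ} (x : Fin n → ℝ) :
    ∏ j, ∏ k ∈ univ.erase j, |x j - x k| = absVandermonde x ^ 2 := by
  have h (j : Fin n) : ∏ k ∈ univ.erase j, |x j - x k| =
      (∏ k ∈ Ioi j, |x k - x j|) * ∏ k ∈ Iio j, |x j - x k| := by
    have : univ.erase j = Ioi j ∪ Iio j := by ext k; simp [lt_or_lt_iff_ne, eq_comm]
    rw [this, prod_union]
    · exact congrArg (· * _) (prod_congr rfl fun k _ => abs_sub_comm _ _)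
    · exact disjoint_left.2 fun k hk hk' => lt_asymm (mem_Ioi.1 hk) (mem_Iio.1 hk')
  simp_rw [h, prod_mul_distrib]
  rw [sq, absVandermonde]
  congr 1
  exact prod_comm' (by simp)

/-- The matrix of the functionals value at `y i` and coefficient of degree `n` in the monomial
basis. -/
noncomputable def borderedVandermonde {n : ℕ} (y : Fin n → ℝ) :
    Matrix (Fin (n + 1)) (Fin (n + 1)) ℝ :=
  Matrix.of (Fin.snoc (fun i k => y i ^ (k : ℕ)) (Pi.single (Fin.last n) 1))

lemma abs_det_borderedVandermonde {n : ℕ} (y : Fin n → ℝ) :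
    |(borderedVandermonde y).det| = absVandermonde y := by
  rw [Matrix.det_succ_row _ (Fin.last n), Finset.sum_eq_single (Fin.last n)]
  · rw [← abs_det_vandermonde]
    have : (borderedVandermonde y).submatrix (Fin.last n).succAbove (Fin.last n).succAbove =
        Matrix.vandermonde y := by
      ext i j
      simp [borderedVandermonde, Matrix.vandermonde_apply]
    rw [this]
    simp [borderedVandermonde]
  · intro j _ hj
    simp [borderedVandermonde, hj]
  · simp

/-- The matrix of coefficients of a family of polynomials. -/
noncomputable def coeffMatrix {n : ℕ} (q : Fin n → Polynomial ℝ) : Matrix (Fin n) (Fin n) ℝ :=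
  Matrix.of fun k j => (q j).coeff k

lemma vandermonde_mul_coeffMatrix {n : ℕ} (x : Fin n → ℝ) {q : Fin n → Polynomial ℝ}
    (hq : ∀ j, (q j).natDegree < n) :
    Matrix.vandermonde x * coeffMatrix q = Matrix.of fun i j => (q j).eval (x i) := by
  ext i j
  simp only [Matrix.mul_apply, Matrix.vandermonde_apply, coeffMatrix, Matrix.of_apply]
  rw [Polynomial.eval_eq_sum_range' (hq j), ← Fin.sum_univ_eq_sum_range
    (fun k => (q j).coeff k * x i ^ k)]
  exact sum_congr rfl fun _ _ => mul_comm _ _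

lemma borderedVandermonde_mul_coeffMatrix {n : ℕ} (y : Fin n → ℝ)
    {q : Fin (n + 1) → Polynomial ℝ} (hq : ∀ j, (q j).natDegree < n + 1) :
    borderedVandermonde y * coeffMatrix q =
      Matrix.of (Fin.snoc (fun i j => (q j).eval (y i)) fun j => (q j).coeff n) := by
  ext i j
  simp only [Matrix.mul_apply, borderedVandermonde, coeffMatrix, Matrix.of_apply]
  induction i using Fin.lastCases with
  | last => simp [Pi.single_apply]
  | cast i =>
    simp only [Fin.snoc_castSucc]
    rw [Polynomial.eval_eq_sum_range' (hq j), ← Fin.sum_univ_eq_sum_range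
      (fun k => (q j).coeff k * y i ^ k)]
    exact sum_congr rfl fun _ _ => mul_comm _ _

lemma abs_det_coeffMatrix_nodal_erase {n : ℕ} {x : Fin (n + 1) → ℝ}
    (hx : Function.Injective x) :
    |(coeffMatrix fun j => Lagrange.nodal (univ.erase j) x).det| = absVandermonde x := by
  have h := vandermonde_mul_coeffMatrix x (q := fun j => Lagrange.nodal (univ.erase j) x)
    (by simp [Lagrange.natDegree_nodal])
  have hd : (Matrix.of fun i j => (Lagrange.nodal (univ.erase j) x).eval (x i)) =
      Matrix.diagonal fun j => ∏ k ∈ univ.erase j, (x j - x k) := by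
    ext i j
    rcases eq_or_ne i j with rfl | hij
    · simp [Lagrange.eval_nodal]
    · rw [Matrix.diagonal_apply_ne _ hij, Matrix.of_apply]
      exact Lagrange.eval_nodal_at_node (mem_erase.2 ⟨hij, mem_univ i⟩)
  have h' := congrArg (fun M => |M.det|) (h.trans hd)
  simp only [Matrix.det_mul, abs_mul, abs_det_vandermonde, Matrix.det_diagonal, abs_prod,
    prod_prod_erase_abs_sub] at h'
  exact mul_left_cancel₀ (absVandermonde_pos hx).ne' (h'.trans (sq _))

lemma coeff_nodal_card {n : ℕ} {ι : Type*} {s : Finset ι} (hs : #s = n) (x : ι → ℝ) :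
    (Lagrange.nodal s x).coeff n = 1 := by
  have h := (Lagrange.nodal_monic (s := s) (v := x)).coeff_natDegree
  rwa [Lagrange.natDegree_nodal, hs] at h

lemma abs_det_coeffMatrix_nodal_snoc {n : ℕ} {y : Fin n → ℝ} (hy : Function.Injective y) :
    |(coeffMatrix (Fin.snoc (fun i => Lagrange.nodal (univ.erase i) y)
      (Lagrange.nodal univ y))).det| = absVandermonde y := by
  set q : Fin (n + 1) → Polynomial ℝ :=
    Fin.snoc (fun i => Lagrange.nodal (univ.erase i) y) (Lagrange.nodal univ y) with hq
  have h := borderedVandermonde_mul_coeffMatrix y (q := q) (fun j => by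
    induction j using Fin.lastCases with
    | last => simp [hq, Lagrange.natDegree_nodal]
    | cast j => simp [hq, Lagrange.natDegree_nodal])
  have hd : (Matrix.of (Fin.snoc (fun i j => (q j).eval (y i)) fun j => (q j).coeff n)) =
      Matrix.diagonal (Fin.snoc (fun j => ∏ k ∈ univ.erase j, (y j - y k)) 1 :
        Fin (n + 1) → ℝ) := by
    ext i j
    induction i using Fin.lastCases with
    | last =>
      induction j using Fin.lastCases with
      | last => simp [hq, coeff_nodal_card]
      | cast j =>
        rw [Matrix.diagonal_apply_ne _ (Fin.castSucc_ne_last j).symm]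
        simp only [Matrix.of_apply, Fin.snoc_last, hq, Fin.snoc_castSucc]
        apply Polynomial.coeff_eq_zero_of_natDegree_lt
        rw [Lagrange.natDegree_nodal, card_erase_of_mem (mem_univ j), card_fin]
        have := j.2
        omega
    | cast i =>
      induction j using Fin.lastCases with
      | last =>
        rw [Matrix.diagonal_apply_ne _ (Fin.castSucc_ne_last i)]
        simp [hq, Lagrange.eval_nodal_at_node]
      | cast j =>
        rcases eq_or_ne i j with rfl | hij
        · simp [hq, Lagrange.eval_nodal]
        · rw [Matrix.diagonal_apply_ne _ (by simpa using hij)]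
          simp only [Matrix.of_apply, Fin.snoc_castSucc, hq]
          exact Lagrange.eval_nodal_at_node (mem_erase.2 ⟨hij, mem_univ i⟩)
  have h' := congrArg (fun M => |M.det|) (h.trans hd)
  simp only [Matrix.det_mul, abs_mul, abs_det_borderedVandermonde, Matrix.det_diagonal, abs_prod,
    Fin.prod_univ_castSucc, Fin.snoc_castSucc, Fin.snoc_last, mul_one,
    prod_prod_erase_abs_sub] at h'
  exact mul_left_cancel₀ (absVandermonde_pos hy).ne' (h'.trans (sq _))

lemma abs_det_snoc_eval_nodal_erase {n : ℕ} (y : Fin n → ℝ) {x : Fin (n + 1) → ℝ}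
    (hx : Function.Injective x) :
    |(Matrix.of (Fin.snoc (fun i j => ∏ k ∈ univ.erase j, (y i - x k)) fun _ => 1) :
      Matrix (Fin (n + 1)) (Fin (n + 1)) ℝ).det| = absVandermonde y * absVandermonde x := by
  rw [← abs_det_borderedVandermonde, ← abs_det_coeffMatrix_nodal_erase hx, ← abs_mul,
    ← Matrix.det_mul, borderedVandermonde_mul_coeffMatrix _ (by simp [Lagrange.natDegree_nodal])]
  simp [Lagrange.eval_nodal, coeff_nodal_card]

lemma abs_det_eval_nodal_snoc {n : ℕ} {y : Fin n → ℝ} (hy : Function.Injective y)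
    (x : Fin (n + 1) → ℝ) :
    |(Matrix.of fun j => Fin.snoc (fun i => ∏ k ∈ univ.erase i, (x j - y k)) (∏ k, (x j - y k)) :
      Matrix (Fin (n + 1)) (Fin (n + 1)) ℝ).det| = absVandermonde x * absVandermonde y := by
  rw [← abs_det_vandermonde, ← abs_det_coeffMatrix_nodal_snoc hy, ← abs_mul,
    ← Matrix.det_mul, vandermonde_mul_coeffMatrix]
  · congr 2
    ext i j
    induction j using Fin.lastCases <;> simp [Lagrange.eval_nodal]
  · intro j
    induction j using Fin.lastCases with
    | last => simp [Lagrange.natDegree_nodal]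
    | cast j => simp [Lagrange.natDegree_nodal]

lemma prod_eq_neg_one_pow_mul_prod_abs {ι : Type*} {s : Finset ι} {f : ι → ℝ} :
    ∏ i ∈ s, f i = (-1) ^ #{i ∈ s | f i < 0} * ∏ i ∈ s, |f i| := by
  rw [← prod_const, prod_filter, ← prod_mul_distrib]
  refine prod_congr rfl fun i _ => ?_
  split_ifs with h
  · rw [abs_of_neg h]; ring
  · rw [abs_of_nonneg (not_lt.1 h), one_mul]

lemma neg_one_pow_mul_prod_pos {ι : Type*} {s : Finset ι} {f : ι → ℝ} {m : ℕ}
    (hf : ∀ i ∈ s, f i ≠ 0) (hm : #{i ∈ s | f i < 0} = m) :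
    0 < (-1) ^ m * ∏ i ∈ s, f i := by
  rw [prod_eq_neg_one_pow_mul_prod_abs, hm, ← mul_assoc, ← mul_pow]
  simpa using prod_pos fun i hi => abs_pos.2 (hf i hi)

lemma Interlaces.lt_iff {n : ℕ} {y : Fin n → ℝ} {x : Fin (n + 1) → ℝ} (h : Interlaces y x)
    (i : Fin n) (j : Fin (n + 1)) : y i < x j ↔ i.castSucc < j := by
  constructor
  · intro hij
    by_contra! hc
    exact (hij.trans_le (h.strictMono_right.monotone hc)).not_gt (h i).1
  · intro hij
    exact (h i).2.trans_le (h.strictMono_right.monotone (Fin.castSucc_lt_iff_succ_le.1 hij))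

lemma Interlaces.ne {n : ℕ} {y : Fin n → ℝ} {x : Fin (n + 1) → ℝ} (h : Interlaces y x)
    (i : Fin n) (j : Fin (n + 1)) : y i ≠ x j := by
  rcases lt_or_ge i.castSucc j with hij | hij
  · exact ((h.lt_iff i j).2 hij).ne
  · exact ((h.strictMono_right.monotone hij).trans_lt (h i).1).ne'

lemma Interlaces.prod_right_pos {n : ℕ} {y : Fin n → ℝ} {x : Fin (n + 1) → ℝ}
    (h : Interlaces y x) (i : Fin n) : 0 < (-1) ^ (n - i : ℕ) * ∏ j, (y i - x j) := by
  refine neg_one_pow_mul_prod_pos (fun j _ => sub_ne_zero.2 (h.ne i j)) ?_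
  simp_rw [sub_neg, h.lt_iff]
  rw [filter_lt_eq_Ioi, Fin.card_Ioi]
  simp

lemma Interlaces.prod_left_pos {n : ℕ} {y : Fin n → ℝ} {x : Fin (n + 1) → ℝ}
    (h : Interlaces y x) (j : Fin (n + 1)) : 0 < (-1) ^ (n - j : ℕ) * ∏ i, (x j - y i) := by
  refine neg_one_pow_mul_prod_pos (fun i _ => sub_ne_zero.2 (h.ne i j).symm) ?_
  have h' (i : Fin n) : x j - y i < 0 ↔ ¬ i.castSucc < j := by
    rw [sub_neg, ← h.lt_iff, not_lt]
    exact ⟨le_of_lt, fun hi => hi.lt_of_ne (h.ne i j).symm⟩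
  simp_rw [h']
  have hc := card_filter_add_card_filter_not (s := (univ : Finset (Fin n)))
    (fun i => i.castSucc < j)
  have hcard : #{i : Fin n | i.castSucc < j} = j := by
    simp_rw [Fin.lt_def, Fin.val_castSucc]
    rw [Fin.card_filter_val_lt]
    omega
  rw [hcard, card_fin] at hc
  omega

lemma StrictMono.prod_erase_pos {n : ℕ} {x : Fin (n + 1) → ℝ} (hx : StrictMono x)
    (j : Fin (n + 1)) : 0 < (-1) ^ (n - j : ℕ) * ∏ k ∈ univ.erase j, (x j - x k) := by
  refine neg_one_pow_mul_prod_pos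
    (fun k hk => sub_ne_zero.2 (hx.injective.ne (mem_erase.1 hk).1.symm)) ?_
  have : {k ∈ univ.erase j | x j - x k < 0} = Ioi j := by
    ext k
    simp only [mem_filter, mem_erase, mem_univ, and_true, sub_neg, hx.lt_iff_lt, mem_Ioi]
    exact ⟨fun h => h.2, fun h => ⟨h.ne', h⟩⟩
  rw [this, Fin.card_Ioi]
  simp

lemma exists_interlaces_roots {n : ℕ} {x : Fin (n + 1) → ℝ} (hx : StrictMono x)
    {P : Polynomial ℝ} (hP : ∀ k : Fin (n + 1), 0 < (-1) ^ (n - k : ℕ) * P.eval (x k)) :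
    ∃ y, Interlaces y x ∧ ∀ i, P.eval (y i) = 0 := by
  have h (i : Fin n) : ∃ t, (x i.castSucc < t ∧ t < x i.succ) ∧ P.eval t = 0 := by
    set Q := Polynomial.C ((-1 : ℝ) ^ (n - i.succ : ℕ)) * P with hQ
    have h1 : 0 < Q.eval (x i.succ) := by simpa [hQ] using hP i.succ
    have h0 : Q.eval (x i.castSucc) < 0 := by
      have := hP i.castSucc
      rw [show (n - (i.castSucc : ℕ)) = (n - i.succ : ℕ) + 1 by simp; omega, pow_succ] at this
      simp only [hQ, Polynomial.eval_mul, Polynomial.eval_C]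
      linarith
    obtain ⟨t, ht, ht'⟩ := intermediate_value_Ioo (hx i.castSucc_lt_succ).le
      Q.continuous.continuousOn ⟨h0, h1⟩
    refine ⟨t, ht, ?_⟩
    simpa [hQ] using ht'
  choose y hy using h
  exact ⟨y, fun i => (hy i).1, fun i => (hy i).2⟩

open Polynomial in
lemma eq_C_mul_nodal {n : ℕ} {y : Fin n → ℝ} (hy : Function.Injective y) {P : ℝ[X]}
    (hP : P.natDegree ≤ n) (hr : ∀ i, P.eval (y i) = 0) :
    P = C (P.coeff n) * Lagrange.nodal univ y := by
  refine eq_of_degree_sub_lt_of_eval_index_eq univ hy.injOn ?_ fun i _ => ?_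
  · rw [degree_lt_iff_coeff_zero]
    intro m hm
    rw [card_fin] at hm
    rcases hm.eq_or_lt with rfl | hm
    · simp [coeff_nodal_card]
    · rw [coeff_sub, coeff_C_mul, coeff_eq_zero_of_natDegree_lt (hP.trans_lt hm),
        coeff_eq_zero_of_natDegree_lt (p := Lagrange.nodal _ _)
          (by simpa [Lagrange.natDegree_nodal] using hm)]
      simp
  · simp [hr, Lagrange.eval_nodal_at_node]

lemma StrictMono.eq_of_nodal_eq {n : ℕ} {x y : Fin n → ℝ} (hx : StrictMono x) (hy : StrictMono y)
    (h : Lagrange.nodal univ x = Lagrange.nodal univ y) : x = y := by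
  have key (x : Fin n → ℝ) : Set.range x = {t | (Lagrange.nodal univ x).eval t = 0} := by
    ext t
    simp [Lagrange.eval_nodal, prod_eq_zero_iff, sub_eq_zero, eq_comm (a := t)]
  rw [← hx.range_inj hy, key, key, h]

lemma coeff_nodal_pred {n : ℕ} (x : Fin (n + 1) → ℝ) :
    (Lagrange.nodal univ x).coeff n = -∑ i, x i := by
  rw [← Polynomial.prod_X_sub_C_nextCoeff, ← Lagrange.nodal_eq,
    Polynomial.nextCoeff_of_natDegree_pos (by simp [Lagrange.natDegree_nodal])]
  simp [Lagrange.natDegree_nodal]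

open Polynomial in
lemma coeff_X_sq_mul_nodal {n : ℕ} (x : Fin n → ℝ) :
    2 * (X ^ 2 * Lagrange.nodal univ x).coeff n = (∑ i, x i) ^ 2 - ∑ i, x i ^ 2 := by
  induction n with
  | zero => simp [Lagrange.nodal_eq]
  | succ n ih =>
    have h : Lagrange.nodal univ x = Lagrange.nodal univ (x ∘ Fin.castSucc) *
        (X - C (x (Fin.last n))) := by
      simp [Lagrange.nodal_eq, Fin.prod_univ_castSucc]
    have h1 : (X ^ 2 * Lagrange.nodal univ (x ∘ Fin.castSucc)).coeff (n + 1) =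
        -∑ i, x (Fin.castSucc i) := by
      cases n with
      | zero => simp [Lagrange.nodal_eq]
      | succ n =>
        exact (coeff_X_pow_mul _ 2 n).trans (coeff_nodal_pred _)
    rw [h, ← mul_assoc, coeff_mul_X_sub_C, h1, mul_sub, ih, Fin.sum_univ_castSucc,
      Fin.sum_univ_castSucc]
    simp only [Function.comp_apply]
    ring

lemma lintegral_fin_snoc {n : ℕ} {F : (Fin (n + 1) → ℝ) → ENNReal} (hF : Measurable F) :
    ∫⁻ x, F x = ∫⁻ y : Fin n → ℝ, ∫⁻ t, F (Fin.snoc y t) := by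
  rw [← (volume_preserving_piFinSuccAbove (fun _ : Fin (n + 1) => ℝ) (Fin.last n)).symm
    |>.lintegral_comp hF, Measure.volume_eq_prod, lintegral_prod_symm' _ (by fun_prop)]
  simp [MeasurableEquiv.piFinSuccAbove, Fin.insertNthEquiv, Fin.insertNth_last']

lemma lintegral_fin_prod {n : ℕ} {f : Fin n → ℝ → ENNReal} (hf : ∀ i, Measurable (f i)) :
    ∫⁻ x : Fin n → ℝ, ∏ i, f i (x i) = ∏ i, ∫⁻ t, f i t := by
  induction n with
  | zero => simp [volume_pi]
  | succ n ih =>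
    rw [lintegral_fin_snoc (by fun_prop)]
    simp_rw [Fin.prod_univ_castSucc, Fin.snoc_castSucc, Fin.snoc_last]
    rw [← ih fun i => hf _, ← lintegral_mul_const _ (by fun_prop)]
    exact lintegral_congr fun y => lintegral_const_mul _ (hf _)

lemma lintegral_rpow_mul_exp {c r : ℝ} (hc : 0 < c) (hr : 0 < r) :
    ∫⁻ t in Set.Ioi 0, ENNReal.ofReal (t ^ (c - 1) * exp (-(r * t))) =
      ENNReal.ofReal ((1 / r) ^ c * Gamma c) := by
  rw [← integral_rpow_mul_exp_neg_mul_Ioi hc hr, ofReal_integral_eq_lintegral_ofReal]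
  · apply Integrable.of_integral_ne_zero
    rw [integral_rpow_mul_exp_neg_mul_Ioi hc hr]
    have := Gamma_pos_of_pos hc
    positivity
  · filter_upwards [self_mem_ae_restrict measurableSet_Ioi] with t (ht : 0 < t)
    simp only [Pi.zero_apply]
    positivity

lemma lintegral_gaussian {a : ℝ} (ha : 0 < a) :
    ∫⁻ t : ℝ, ENNReal.ofReal (exp (-a * t ^ 2)) = ENNReal.ofReal √(π / a) := by
  rw [← integral_gaussian, ofReal_integral_eq_lintegral_ofReal]
  · exact integrable_exp_neg_mul_sq ha
  · exact ae_of_all _ fun t => (exp_pos _).le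

lemma lintegral_image_eq_lintegral_abs_matrix_det {n : ℕ} {S : Set (Fin n → ℝ)}
    (hS : MeasurableSet S) {f : (Fin n → ℝ) → Fin n → ℝ}
    {M : (Fin n → ℝ) → Matrix (Fin n) (Fin n) ℝ}
    (hf : ∀ x ∈ S, ∀ i, HasFDerivAt (fun z => f z i)
      (∑ j, M x i j • (ContinuousLinearMap.proj j : (Fin n → ℝ) →L[ℝ] ℝ)) x)
    (hinj : Set.InjOn f S) (g : (Fin n → ℝ) → ENNReal) :
    ∫⁻ v in f '' S, g v = ∫⁻ x in S, ENNReal.ofReal |(M x).det| * g (f x) := by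
  have h := lintegral_image_eq_lintegral_abs_det_fderiv_mul volume hS
    (f' := fun x => LinearMap.toContinuousLinearMap (Matrix.toLin' (M x)))
    (fun x hx => HasFDerivAt.hasFDerivWithinAt ?_) hinj g
  · simpa [ContinuousLinearMap.det] using h
  · rw [hasFDerivAt_pi']
    intro i
    refine (hf x hx i).congr_fderiv ?_
    ext v
    simp [Matrix.mulVec, dotProduct]

/-- The product of all distances between the points of `y` and the points of `x`. -/
noncomputable def crossProd {n m : ℕ} (y : Fin n → ℝ) (x : Fin m → ℝ) : ℝ :=
  ∏ i, ∏ j, |y i - x j|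

lemma isOpen_setOf_interlaces (n : ℕ) :
    IsOpen {p : (Fin n → ℝ) × (Fin (n + 1) → ℝ) | Interlaces p.1 p.2} := by
  have h : {p : (Fin n → ℝ) × (Fin (n + 1) → ℝ) | Interlaces p.1 p.2} =
      ⋂ i : Fin n, {p | p.2 i.castSucc < p.1 i} ∩ {p | p.1 i < p.2 i.succ} := by
    ext p
    simp [Interlaces]
  rw [h]
  exact isOpen_iInter_of_finite fun i =>
    (isOpen_lt (by fun_prop) (by fun_prop)).inter (isOpen_lt (by fun_prop) (by fun_prop))

lemma measurableSet_setOf_interlaces_right {n : ℕ} (y : Fin n → ℝ) :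
    MeasurableSet {x | Interlaces y x} :=
  ((isOpen_setOf_interlaces n).preimage (by fun_prop : Continuous fun x => (y, x))).measurableSet

lemma measurableSet_setOf_interlaces_left {n : ℕ} (x : Fin (n + 1) → ℝ) :
    MeasurableSet {y | Interlaces y x} :=
  ((isOpen_setOf_interlaces n).preimage
    (by fun_prop : Continuous fun y => (y, x))).measurableSet

lemma hasFDerivAt_prod_sub {n : ℕ} (c : ℝ) (x : Fin n → ℝ) :
    HasFDerivAt (fun z : Fin n → ℝ => ∏ j, (c - z j))
      (∑ j, (-∏ k ∈ univ.erase j, (c - x k)) •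
        (ContinuousLinearMap.proj j : (Fin n → ℝ) →L[ℝ] ℝ)) x := by
  have h := HasFDerivAt.finsetProd (u := univ) (x := x) (g := fun j (z : Fin n → ℝ) => c - z j)
    (g' := fun j => -(ContinuousLinearMap.proj j : (Fin n → ℝ) →L[ℝ] ℝ))
    (fun j _ => (hasFDerivAt_apply j x).const_sub c)
  refine h.congr_fderiv ?_
  ext v
  simp

/-- For fixed nodes `y`, the coordinates of the monic polynomial with roots `x`: its values at the
nodes, up to sign, and the shift of the sum of its roots. -/
noncomputable def nodeValues {n : ℕ} (y : Fin n → ℝ) (x : Fin (n + 1) → ℝ) : Fin (n + 1) → ℝ :=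
  Fin.snoc (fun i => (-1) ^ (n - i : ℕ) * ∏ j, (y i - x j)) (∑ j, x j - ∑ i, y i)

/-- For fixed nodes `x`, the values at the nodes, up to sign, of the polynomial whose roots and
leading coefficient are given by `z`. -/
noncomputable def scaledNodeValues {n : ℕ} (x z : Fin (n + 1) → ℝ) : Fin (n + 1) → ℝ :=
  fun j => (-1) ^ (n - j : ℕ) * (z (Fin.last n) * ∏ i, (x j - Fin.init z i))

lemma lintegral_image_nodeValues {n : ℕ} {y : Fin n → ℝ}
    (hinj : Set.InjOn (nodeValues y) {x | Interlaces y x}) (g : (Fin (n + 1) → ℝ) → ENNReal) :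
    ∫⁻ v in nodeValues y '' {x | Interlaces y x}, g v =
      ∫⁻ x in {x | Interlaces y x},
        ENNReal.ofReal (absVandermonde y * absVandermonde x) * g (nodeValues y x) := by
  rw [lintegral_image_eq_lintegral_abs_matrix_det (measurableSet_setOf_interlaces_right y)
    (M := fun x => Matrix.of fun i j =>
      (Fin.snoc (fun i => -(-1) ^ (n - i : ℕ)) 1 : Fin (n + 1) → ℝ) i *
      (Matrix.of (Fin.snoc (fun i j => ∏ k ∈ univ.erase j, (y i - x k)) fun _ => 1) :
        Matrix (Fin (n + 1)) (Fin (n + 1)) ℝ) i j) _ hinj]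
  · refine setLIntegral_congr_fun (measurableSet_setOf_interlaces_right y) fun x hx => ?_
    have hx : Interlaces y x := hx
    simp only [Matrix.det_mul_column, abs_mul,
      abs_det_snoc_eval_nodal_erase y hx.strictMono_right.injective]
    simp [Fin.prod_univ_castSucc, abs_prod]
  · intro x _ i
    induction i using Fin.lastCases with
    | last =>
      simp only [nodeValues, Fin.snoc_last, Matrix.of_apply, mul_one, one_smul]
      exact (HasFDerivAt.fun_sum fun j _ => hasFDerivAt_apply j x).sub_const _
    | cast i =>
      simp only [nodeValues, Fin.snoc_castSucc, Matrix.of_apply]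
      refine ((hasFDerivAt_prod_sub (y i) x).const_mul ((-1) ^ (n - i : ℕ))).congr_fderiv ?_
      ext v
      simp [mul_sum, mul_assoc]

lemma lintegral_image_scaledNodeValues {n : ℕ} {x : Fin (n + 1) → ℝ} {S : Set (Fin (n + 1) → ℝ)}
    (hS : MeasurableSet S) (hS' : ∀ z ∈ S, Function.Injective (Fin.init z : Fin n → ℝ))
    (hinj : Set.InjOn (scaledNodeValues x) S) (g : (Fin (n + 1) → ℝ) → ENNReal) :
    ∫⁻ v in scaledNodeValues x '' S, g v =
      ∫⁻ z in S, ENNReal.ofReal (|z (Fin.last n)| ^ n *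
        (absVandermonde x * absVandermonde (Fin.init z : Fin n → ℝ))) *
          g (scaledNodeValues x z) := by
  rw [lintegral_image_eq_lintegral_abs_matrix_det hS
    (M := fun z => Matrix.of fun j i => (-1) ^ (n - j : ℕ) * Matrix.of (fun j i =>
      (Fin.snoc (fun _ => -z (Fin.last n)) 1 : Fin (n + 1) → ℝ) i *
      (Matrix.of fun j => Fin.snoc (fun i => ∏ k ∈ univ.erase i, (x j - Fin.init z k))
        (∏ k : Fin n, (x j - Fin.init z k)) :
        Matrix (Fin (n + 1)) (Fin (n + 1)) ℝ) j i) j i) _ hinj]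
  · refine setLIntegral_congr_fun hS fun z hz => ?_
    simp only [Matrix.det_mul_column, Matrix.det_mul_row, abs_mul,
      abs_det_eval_nodal_snoc (hS' z hz) x]
    simp [Fin.prod_univ_castSucc, abs_prod, mul_assoc]
  · intro z _ j
    let init : (Fin (n + 1) → ℝ) →L[ℝ] (Fin n → ℝ) :=
      ContinuousLinearMap.pi fun i => ContinuousLinearMap.proj i.castSucc
    have h1 := (hasFDerivAt_prod_sub (x j) (Fin.init z)).comp z init.hasFDerivAt
    refine (((hasFDerivAt_apply (Fin.last n) z).mul h1).const_mul
      ((-1) ^ (n - j : ℕ))).congr_fderiv ?_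
    ext v
    simp [Fin.sum_univ_castSucc, init, mul_sum, mul_comm, mul_left_comm]

open Polynomial in
lemma injOn_nodeValues {n : ℕ} (y : Fin n → ℝ) :
    Set.InjOn (nodeValues y) {x | Interlaces y x} := by
  intro x (hx : Interlaces y x) x' (hx' : Interlaces y x') h
  refine hx.strictMono_right.eq_of_nodal_eq hx'.strictMono_right ?_
  refine eq_of_degree_sub_lt_of_eval_index_eq univ hx.strictMono_left.injective.injOn ?_
    fun i _ => ?_
  · rw [degree_lt_iff_coeff_zero]
    intro m hm
    rw [card_fin] at hm
    obtain rfl | rfl | hm : m = n ∨ m = n + 1 ∨ n + 1 < m := by omega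
    · have h := congrFun h (Fin.last m)
      simp only [nodeValues, Fin.snoc_last, sub_left_inj] at h
      simp [coeff_nodal_pred, h]
    · simp [coeff_nodal_card]
    · rw [coeff_sub, coeff_eq_zero_of_natDegree_lt, coeff_eq_zero_of_natDegree_lt, sub_zero] <;>
        simpa [Lagrange.natDegree_nodal] using hm
  · have h := congrFun h i.castSucc
    simpa [nodeValues, Lagrange.eval_nodal] using h

open Polynomial Filter in
lemma exists_eval_pos_of_monic {n : ℕ} {P : ℝ[X]} (hP : P.Monic) (hn : P.natDegree = n + 1)
    (y : Fin n → ℝ) :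
    ∃ A B, A < B ∧ (∀ i, A < y i) ∧ (∀ i, y i < B) ∧
      0 < (-1) ^ (n + 1) * P.eval A ∧ 0 < P.eval B := by
  have hb (y : Fin n → ℝ) : ∀ᶠ t in atTop, 0 < t ∧ ∀ i, y i < t :=
    (eventually_gt_atTop 0).and (eventually_all.2 fun i => eventually_gt_atTop (y i))
  have h1 : Tendsto (fun t => P.eval t) atTop atTop :=
    P.tendsto_atTop_of_leadingCoeff_nonneg (natDegree_pos_iff_degree_pos.1 (by omega))
      (by simp [hP.leadingCoeff])
  have h2 : Tendsto (fun t => (C ((-1) ^ (n + 1)) * P.comp (-X)).eval t) atTop atTop := by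
    refine tendsto_atTop_of_leadingCoeff_nonneg _ (natDegree_pos_iff_degree_pos.1 ?_) ?_
    · rw [natDegree_C_mul (by simp), natDegree_comp]
      simp [hn]
    · rw [leadingCoeff_mul, leadingCoeff_C, leadingCoeff_comp (by simp), hP.leadingCoeff, hn]
      simp [← mul_pow]
  obtain ⟨B, hB, hB0, hB'⟩ := ((h1.eventually_gt_atTop 0).and (hb y)).exists
  obtain ⟨A, hA, hA0, hA'⟩ := ((h2.eventually_gt_atTop 0).and (hb (-y))).exists
  refine ⟨-A, B, by linarith, fun i => neg_lt.1 (hA' i), hB', ?_, hB⟩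
  simpa using hA

lemma StrictMono.fin_cons_snoc {n : ℕ} {y : Fin n → ℝ} (hy : StrictMono y) {A B : ℝ}
    (hAB : A < B) (hA : ∀ i, A < y i) (hB : ∀ i, y i < B) :
    StrictMono (Fin.cons A (Fin.snoc y B : Fin (n + 1) → ℝ) : Fin (n + 2) → ℝ) := by
  intro i j hij
  induction i using Fin.cases with
  | zero =>
    induction j using Fin.cases with
    | zero => exact absurd hij (lt_irrefl _)
    | succ j => induction j using Fin.lastCases <;> simp [*]
  | succ i =>
    induction j using Fin.cases with
    | zero => exact absurd hij (Fin.not_lt_zero _)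
    | succ j =>
      rw [Fin.succ_lt_succ_iff] at hij
      induction j using Fin.lastCases with
      | last =>
        induction i using Fin.lastCases with
        | last => exact absurd hij (lt_irrefl _)
        | cast i => simpa using hB i
      | cast j =>
        induction i using Fin.lastCases with
        | last => exact absurd hij (Fin.le_last _).not_gt
        | cast i => simpa using hy (by simpa using hij)

open Polynomial in
lemma image_nodeValues {n : ℕ} {y : Fin n → ℝ} (hy : StrictMono y) :
    nodeValues y '' {x | Interlaces y x} = {v | ∀ i : Fin n, 0 < v i.castSucc} := by
  ext v
  constructor
  · rintro ⟨x, hx, rfl⟩ i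
    simpa [nodeValues] using Interlaces.prod_right_pos hx i
  intro hv
  have hv (i : Fin n) : 0 < v i.castSucc := hv i
  set R := Lagrange.interpolate univ y fun i => (-1) ^ (n - i : ℕ) * v i.castSucc with hR
  have hRn : R.degree < (n : WithBot ℕ) := by
    have h := Lagrange.degree_interpolate_lt (s := univ)
      (fun i : Fin n => (-1) ^ (n - i : ℕ) * v i.castSucc) hy.injective.injOn
    rwa [card_fin] at h
  have hnod : Lagrange.nodal univ y * (X - C (v (Fin.last n))) =
      Lagrange.nodal univ (Fin.snoc y (v (Fin.last n)) : Fin (n + 1) → ℝ) := by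
    simp [Lagrange.nodal_eq, Fin.prod_univ_castSucc]
  set Q := Lagrange.nodal univ (Fin.snoc y (v (Fin.last n)) : Fin (n + 1) → ℝ) with hQ
  have hQn : Q.natDegree = n + 1 := by simp [hQ, Lagrange.natDegree_nodal]
  have hQm : Q.Monic := Lagrange.nodal_monic
  have hRQ : R.degree < Q.degree := by
    rw [degree_eq_natDegree hQm.ne_zero, hQn]
    exact hRn.trans (by exact_mod_cast n.lt_succ_self)
  have hPm : (Q + R).Monic := hQm.add_of_left hRQ
  have hPn : (Q + R).natDegree = n + 1 := by rw [natDegree_add_eq_left_of_degree_lt hRQ, hQn]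
  have hPe (i : Fin n) : (Q + R).eval (y i) = (-1) ^ (n - i : ℕ) * v i.castSucc := by
    rw [eval_add, ← hnod, hR, Lagrange.eval_interpolate_at_node _ hy.injective.injOn (mem_univ i)]
    simp [Lagrange.eval_nodal_at_node]
  obtain ⟨A, B, hAB, hA, hB, hA', hB'⟩ := exists_eval_pos_of_monic hPm hPn y
  obtain ⟨x, hx, hx'⟩ := exists_interlaces_roots (hy.fin_cons_snoc hAB hA hB) (P := Q + R)
    (fun k => by
      induction k using Fin.cases with
      | zero => simpa using hA'
      | succ k =>
        induction k using Fin.lastCases with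
        | last => simpa using hB'
        | cast k =>
          simp only [Fin.cons_succ, Fin.snoc_castSucc, hPe, ← mul_assoc, ← pow_add]
          simpa using hv k)
  have hP : Q + R = Lagrange.nodal univ x := by
    have h := eq_C_mul_nodal hx.strictMono_left.injective hPn.le hx'
    have hc := hPm.coeff_natDegree
    rw [hPn] at hc
    rwa [hc, C_1, one_mul] at h
  refine ⟨x, fun i => ⟨?_, ?_⟩, ?_⟩
  · simpa using (hx i.castSucc).2
  · have := (hx i.succ).1
    rwa [← Fin.succ_castSucc, Fin.cons_succ, Fin.snoc_castSucc] at this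
  · funext i
    induction i using Fin.lastCases with
    | last =>
      have h := congrArg (fun P => P.coeff n) hP
      simp only [coeff_add, coeff_eq_zero_of_degree_lt hRn, hQ, coeff_nodal_pred,
        Fin.sum_univ_castSucc (Fin.snoc y _), Fin.snoc_castSucc, Fin.snoc_last] at h
      simp only [nodeValues, Fin.snoc_last]
      linarith
    | cast i =>
      have h := hPe i
      rw [hP, Lagrange.eval_nodal] at h
      simp only [nodeValues, Fin.snoc_castSucc, h, ← mul_assoc, ← pow_add]
      simp

open Polynomial in
lemma natDegree_C_mul_nodal_le {n : ℕ} (t : ℝ) (y : Fin n → ℝ) :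
    (C t * Lagrange.nodal univ y).natDegree ≤ n :=
  (natDegree_C_mul_le _ _).trans (by simp [Lagrange.natDegree_nodal])

open Polynomial in
lemma degree_C_mul_nodal_lt {n : ℕ} (t : ℝ) (y : Fin n → ℝ) :
    (C t * Lagrange.nodal univ y).degree < #(univ : Finset (Fin (n + 1))) := by
  rw [card_fin]
  exact degree_le_natDegree.trans_lt
    (by exact_mod_cast Nat.lt_succ_of_le (natDegree_C_mul_nodal_le t y))

open Polynomial in
lemma injOn_scaledNodeValues {n : ℕ} (x : Fin (n + 1) → ℝ) :
    Set.InjOn (scaledNodeValues x)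
      {z | Interlaces (Fin.init z : Fin n → ℝ) x ∧ 0 < z (Fin.last n)} := by
  intro z ⟨hz, ht⟩ z' ⟨hz', _⟩ h
  have hP : C (z (Fin.last n)) * Lagrange.nodal univ (Fin.init z : Fin n → ℝ) =
      C (z' (Fin.last n)) * Lagrange.nodal univ (Fin.init z' : Fin n → ℝ) := by
    refine eq_of_degrees_lt_of_eval_index_eq univ hz.strictMono_right.injective.injOn
      (degree_C_mul_nodal_lt _ _) (degree_C_mul_nodal_lt _ _) fun j _ => ?_
    have h := congrFun h j
    simpa [scaledNodeValues, Lagrange.eval_nodal] using h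
  have ht' : z (Fin.last n) = z' (Fin.last n) := by
    simpa [coeff_nodal_card] using congrArg (fun P => P.coeff n) hP
  rw [← ht'] at hP
  have hi := hz.strictMono_left.eq_of_nodal_eq hz'.strictMono_left
    (mul_left_cancel₀ (C_ne_zero.2 ht.ne') hP)
  rw [← Fin.snoc_init_self z, ← Fin.snoc_init_self z', hi, ht']

open Polynomial in
lemma image_scaledNodeValues {n : ℕ} {x : Fin (n + 1) → ℝ} (hx : StrictMono x) :
    scaledNodeValues x '' {z | Interlaces (Fin.init z : Fin n → ℝ) x ∧ 0 < z (Fin.last n)} =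
      {v | ∀ j, 0 < v j} := by
  ext v
  constructor
  · rintro ⟨z, ⟨hz, ht⟩, rfl⟩ j
    have := mul_pos ht (hz.prod_left_pos j)
    rw [mul_left_comm] at this
    exact this
  intro hv
  have hv (j : Fin (n + 1)) : 0 < v j := hv j
  set P := Lagrange.interpolate univ x fun j => (-1) ^ (n - j : ℕ) * v j with hP
  have hPn : P.natDegree ≤ n := by
    have h := Lagrange.degree_interpolate_lt (s := univ)
      (fun j : Fin (n + 1) => (-1) ^ (n - j : ℕ) * v j) hx.injective.injOn
    rw [card_fin] at h
    exact natDegree_le_iff_coeff_eq_zero.2 fun m hm =>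
      coeff_eq_zero_of_degree_lt (h.trans_le (by exact_mod_cast hm))
  have hPe (j : Fin (n + 1)) : P.eval (x j) = (-1) ^ (n - j : ℕ) * v j :=
    Lagrange.eval_interpolate_at_node _ hx.injective.injOn (mem_univ j)
  obtain ⟨y, hy, hy'⟩ := exists_interlaces_roots hx (P := P) fun k => by
    rw [hPe, ← mul_assoc, ← pow_add]
    simpa using hv k
  have hPy := eq_C_mul_nodal hy.strictMono_left.injective hPn hy'
  have hvj (j : Fin (n + 1)) : (-1) ^ (n - j : ℕ) * (P.coeff n * ∏ i, (x j - y i)) = v j := by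
    have h := hPe j
    rw [hPy] at h
    simp only [eval_mul, eval_C, Lagrange.eval_nodal] at h
    rw [h, ← mul_assoc, ← pow_add]
    simp
  refine ⟨Fin.snoc y (P.coeff n), ⟨by simpa using hy, ?_⟩, ?_⟩
  · have h := hv 0
    rw [← hvj 0, mul_left_comm] at h
    simpa using pos_of_mul_pos_left h (hy.prod_left_pos 0).le
  · funext j
    simp [scaledNodeValues, hvj]

lemma neg_one_pow_mul_eq_abs {m : ℕ} {b : ℝ} (h : 0 < (-1) ^ m * b) : (-1) ^ m * b = |b| := by
  rw [← abs_of_pos h, abs_mul]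
  simp

lemma div_eq_abs_div_abs {m : ℕ} {b c : ℝ} (hb : 0 < (-1) ^ m * b) (hc : 0 < (-1) ^ m * c) :
    b / c = |b| / |c| := by
  rw [← neg_one_pow_mul_eq_abs hb, ← neg_one_pow_mul_eq_abs hc, mul_div_mul_left _ _ (by simp)]

open Polynomial in
/-- Lagrange interpolation for the leading coefficient. -/
lemma Interlaces.sum_div_eq {n : ℕ} {y : Fin n → ℝ} {x : Fin (n + 1) → ℝ} (h : Interlaces y x)
    {t : ℝ} (ht : 0 < t) :
    ∑ j, (t * ∏ i, |x j - y i|) / ∏ k ∈ univ.erase j, |x j - x k| = t := by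
  have hc := Lagrange.coeff_eq_sum h.strictMono_right.injective.injOn (degree_C_mul_nodal_lt t y)
  simp only [card_fin, Nat.add_sub_cancel, coeff_C_mul, coeff_nodal_card, mul_one, eval_mul,
    eval_C, Lagrange.eval_nodal] at hc
  refine (sum_congr rfl fun j _ => ?_).trans hc.symm
  rw [← abs_prod, ← abs_prod, ← abs_of_pos ht, ← abs_mul, abs_of_pos ht]
  refine (div_eq_abs_div_abs (m := n - j) ?_ (h.strictMono_right.prod_erase_pos j)).symm
  rw [mul_left_comm]
  exact mul_pos ht (h.prod_left_pos j)

open Polynomial in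
lemma Interlaces.sum_sq_sub_sum_sq {n : ℕ} {y : Fin n → ℝ} {x : Fin (n + 1) → ℝ}
    (h : Interlaces y x) :
    (∑ j, x j - ∑ i, y i) ^ 2 + 2 * ∑ i, (∏ j, |y i - x j|) / ∏ k ∈ univ.erase i, |y i - y k| =
      ∑ j, x j ^ 2 - ∑ i, y i ^ 2 := by
  cases n with
  | zero => simp
  | succ n =>
    set a := ∑ j, x j - ∑ i, y i with ha
    set R := Lagrange.nodal univ x - Lagrange.nodal univ (Fin.snoc y a : Fin (n + 2) → ℝ) with hR
    have hRd : R.degree < #(univ : Finset (Fin (n + 1))) := by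
      rw [degree_lt_iff_coeff_zero, card_fin]
      intro m hm
      obtain rfl | rfl | hm : m = n + 1 ∨ m = n + 2 ∨ n + 2 < m := by omega
      · simp only [hR, coeff_sub, coeff_nodal_pred, Fin.sum_snoc, ha]
        ring
      · simp [hR, coeff_nodal_card]
      · rw [hR, coeff_sub, coeff_eq_zero_of_natDegree_lt, coeff_eq_zero_of_natDegree_lt,
          sub_zero] <;> simpa [Lagrange.natDegree_nodal] using hm
    have hc := Lagrange.coeff_eq_sum h.strictMono_left.injective.injOn hRd
    have hRe (i : Fin (n + 1)) : R.eval (y i) = ∏ j, (y i - x j) := by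
      simp [hR, Lagrange.eval_nodal, Fin.prod_univ_castSucc (n := n + 1),
        prod_eq_zero (mem_univ i)]
    have hsum : R.coeff n = -∑ i, (∏ j, |y i - x j|) / ∏ k ∈ univ.erase i, |y i - y k| := by
      rw [card_fin, Nat.add_sub_cancel] at hc
      rw [hc, ← sum_neg_distrib]
      refine sum_congr rfl fun i _ => ?_
      have h1 := h.prod_right_pos i
      rw [Nat.succ_sub i.is_le, pow_succ, mul_assoc, neg_one_mul] at h1
      rw [hRe, ← abs_prod, ← abs_prod, ← neg_eq_iff_eq_neg, ← neg_div, ← abs_neg (∏ j, _)]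
      exact div_eq_abs_div_abs h1 (h.strictMono_left.prod_erase_pos i)
    have hx2 := coeff_X_sq_mul_nodal x
    have hy2 := coeff_X_sq_mul_nodal (Fin.snoc y a : Fin (n + 2) → ℝ)
    rw [coeff_X_pow_mul] at hx2 hy2
    rw [Fin.sum_snoc,
      Fin.sum_univ_castSucc fun i => (Fin.snoc y a : Fin (n + 2) → ℝ) i ^ 2] at hy2
    simp only [Fin.snoc_castSucc, Fin.snoc_last] at hy2
    rw [hR, coeff_sub] at hsum
    have hx1 : ∑ j, x j = a + ∑ i, y i := by rw [ha]; ring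
    rw [hx1] at hx2
    linarith

@[fun_prop]
lemma continuous_absVandermonde (n : ℕ) : Continuous fun x : Fin n → ℝ => absVandermonde x := by
  unfold absVandermonde
  fun_prop

@[fun_prop]
lemma continuous_crossProd (n m : ℕ) :
    Continuous fun p : (Fin n → ℝ) × (Fin m → ℝ) => crossProd p.1 p.2 := by
  unfold crossProd
  fun_prop

lemma Interlaces.crossProd_pos {n : ℕ} {y : Fin n → ℝ} {x : Fin (n + 1) → ℝ}
    (h : Interlaces y x) : 0 < crossProd y x :=
  prod_pos fun i _ => prod_pos fun j _ => abs_pos.2 (sub_ne_zero.2 (h.ne i j))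

lemma prod_erase_abs_sub_pos {n : ℕ} {x : Fin n → ℝ} (hx : Function.Injective x) (j : Fin n) :
    0 < ∏ k ∈ univ.erase j, |x j - x k| :=
  prod_pos fun _ hk => abs_pos.2 (sub_ne_zero.2 (hx.ne (mem_erase.1 hk).1.symm))

lemma measurableSet_setOf_strictMono (n : ℕ) : MeasurableSet {x : Fin n → ℝ | StrictMono x} := by
  have : {x : Fin n → ℝ | StrictMono x} = ⋂ i, ⋂ j, ⋂ (_ : i < j), {x | x i < x j} := by
    ext x
    simp [StrictMono]
  rw [this]
  exact MeasurableSet.iInter fun i => MeasurableSet.iInter fun j => MeasurableSet.iInter fun _ =>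
    measurableSet_lt (measurable_pi_apply i) (measurable_pi_apply j)

/-- The unnormalized density of the gamma distribution of shape `c` and rate `r`. -/
noncomputable def gammaWeight (c r : ℝ) : ℝ → ENNReal :=
  (Set.Ioi 0).indicator fun t => ENNReal.ofReal (t ^ (c - 1) * exp (-(r * t)))

@[fun_prop]
lemma measurable_gammaWeight (c r : ℝ) : Measurable (gammaWeight c r) :=
  Measurable.indicator (by fun_prop) measurableSet_Ioi

lemma lintegral_gammaWeight {c r : ℝ} (hc : 0 < c) (hr : 0 < r) :
    ∫⁻ t, gammaWeight c r t = ENNReal.ofReal ((1 / r) ^ c * Gamma c) := by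
  rw [← lintegral_rpow_mul_exp hc hr, gammaWeight, lintegral_indicator measurableSet_Ioi]

lemma gammaWeight_of_pos {c r t : ℝ} (ht : 0 < t) :
    gammaWeight c r t = ENNReal.ofReal (t ^ (c - 1) * exp (-(r * t))) :=
  Set.indicator_of_mem (Set.mem_Ioi.2 ht) _

lemma pos_of_gammaWeight_ne_zero {c r t : ℝ} (h : gammaWeight c r t ≠ 0) : 0 < t :=
  Set.mem_of_indicator_ne_zero h

lemma prod_gammaWeight {ι : Type*} [Fintype ι] {γ : ℝ} {r t : ι → ℝ} (ht : ∀ i, 0 < t i) :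
    ∏ i, gammaWeight γ (r i) (t i) =
      ENNReal.ofReal ((∏ i, t i) ^ (γ - 1) * exp (-∑ i, r i * t i)) := by
  simp_rw [gammaWeight_of_pos (ht _)]
  rw [← ENNReal.ofReal_prod_of_nonneg fun i _ => by have := ht i; positivity, prod_mul_distrib,
    finsetProd_rpow _ _ fun i _ => (ht i).le, ← exp_sum, sum_neg_distrib]

lemma sq_rpow_eq_mul_rpow {v γ : ℝ} (hv : 0 < v) : (v ^ 2) ^ γ = v * v ^ (2 * γ - 1) := by
  rw [← rpow_natCast_mul hv.le, rpow_sub_one hv.ne', mul_div_cancel₀ _ hv.ne']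
  norm_num

/-- Integrating out the outer points of an interlacing pair. -/
lemma lintegral_interlaces_gaussian {n : ℕ} {y : Fin n → ℝ} (hy : StrictMono y) {a γ : ℝ}
    (ha : 0 < a) (hγ : 0 < γ) :
    ∫⁻ x in {x | Interlaces y x},
        ENNReal.ofReal (absVandermonde x * exp (-a * ∑ j, x j ^ 2) * crossProd y x ^ (γ - 1)) =
      ENNReal.ofReal (√(π / a) * (Gamma γ * (2 * a) ^ (-γ)) ^ n *
        (exp (-a * ∑ i, y i ^ 2) * absVandermonde y ^ (2 * γ - 1))) := by
  set D : Fin n → ℝ := fun i => ∏ k ∈ univ.erase i, |y i - y k| with hD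
  have hDpos (i : Fin n) : 0 < D i := prod_erase_abs_sub_pos hy.injective i
  have hV : 0 < absVandermonde y := absVandermonde_pos hy.injective
  set g : (Fin (n + 1) → ℝ) → ENNReal := fun v =>
    (∏ i : Fin n, gammaWeight γ (2 * a / D i) (v i.castSucc)) *
      ENNReal.ofReal (exp (-a * v (Fin.last n) ^ 2)) with hg
  have htotal : ∫⁻ v, g v = ENNReal.ofReal ((∏ i, ((1 / (2 * a / D i)) ^ γ * Gamma γ)) *
      √(π / a)) := by
    have h := lintegral_fin_prod (n := n + 1) (f := Fin.snoc
      (fun i => gammaWeight γ (2 * a / D i)) fun t => ENNReal.ofReal (exp (-a * t ^ 2)))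
      (fun i => by induction i using Fin.lastCases <;> simp <;> fun_prop)
    have hG := Gamma_pos_of_pos hγ
    simp only [Fin.prod_univ_castSucc, Fin.snoc_castSucc, Fin.snoc_last] at h
    rw [h, lintegral_gaussian ha, ENNReal.ofReal_mul' (sqrt_nonneg _),
      ENNReal.ofReal_prod_of_nonneg fun i _ => by have := hDpos i; positivity]
    congr 1
    exact prod_congr rfl fun i _ => lintegral_gammaWeight hγ (by have := hDpos i; positivity)
  have himage : ∫⁻ v in nodeValues y '' {x | Interlaces y x}, g v = ∫⁻ v, g v := by
    rw [image_nodeValues hy, ← lintegral_indicator, Set.indicator_eq_self.2]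
    · intro v hv i
      exact pos_of_gammaWeight_ne_zero (prod_ne_zero_iff.1 (left_ne_zero_of_mul hv) i (mem_univ i))
    · rw [Set.ofPred_forall]
      exact MeasurableSet.iInter fun i => measurableSet_lt measurable_const (measurable_pi_apply _)
  have hchange := lintegral_image_nodeValues (injOn_nodeValues y) g
  rw [himage, htotal] at hchange
  have hintegrand : Set.EqOn (fun x => ENNReal.ofReal (absVandermonde y * absVandermonde x) *
      g (nodeValues y x)) (fun x => ENNReal.ofReal (absVandermonde y * exp (a * ∑ i, y i ^ 2)) *
      ENNReal.ofReal (absVandermonde x * exp (-a * ∑ j, x j ^ 2) * crossProd y x ^ (γ - 1)))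
      {x | Interlaces y x} := by
    intro x (hx : Interlaces y x)
    have hnode (i : Fin n) : nodeValues y x i.castSucc = ∏ j, |y i - x j| := by
      rw [← abs_prod, ← neg_one_pow_mul_eq_abs (hx.prod_right_pos i)]
      simp [nodeValues]
    have hpos (i : Fin n) : 0 < ∏ j, |y i - x j| :=
      prod_pos fun j _ => abs_pos.2 (sub_ne_zero.2 (hx.ne i j))
    have hX := absVandermonde_nonneg x
    have hC := hx.crossProd_pos
    simp only [hg, hnode]
    rw [prod_gammaWeight hpos, ← ENNReal.ofReal_mul (by positivity),
      ← ENNReal.ofReal_mul (by positivity), ← ENNReal.ofReal_mul (by positivity)]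
    congr 1
    have hid := hx.sum_sq_sub_sum_sq
    have hexp : exp (-∑ i, 2 * a / D i * ∏ j, |y i - x j|) *
        exp (-a * nodeValues y x (Fin.last n) ^ 2) =
        exp (a * ∑ i, y i ^ 2) * exp (-a * ∑ j, x j ^ 2) := by
      rw [← exp_add, ← exp_add]
      congr 1
      have : ∑ i, 2 * a / D i * ∏ j, |y i - x j| = 2 * a * ∑ i, (∏ j, |y i - x j|) / D i := by
        rw [mul_sum]
        exact sum_congr rfl fun i _ => by ring
      rw [this]
      simp only [nodeValues, Fin.snoc_last]
      linear_combination (-a) * hid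
    rw [mul_assoc (_ ^ (γ - 1)), hexp]
    simp only [crossProd]
    ring
  rw [setLIntegral_congr_fun (measurableSet_setOf_interlaces_right y) hintegrand,
    lintegral_const_mul' _ _ ENNReal.ofReal_ne_top] at hchange
  rw [← ENNReal.mul_right_inj (a := ENNReal.ofReal (absVandermonde y * exp (a * ∑ i, y i ^ 2)))
    (by simpa using mul_pos hV (exp_pos _)) ENNReal.ofReal_ne_top, ← hchange,
    ← ENNReal.ofReal_mul (by positivity)]
  congr 1
  have h1 : ∏ i, ((1 / (2 * a / D i)) ^ γ * Gamma γ) =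
      (absVandermonde y * absVandermonde y ^ (2 * γ - 1)) * (Gamma γ * (2 * a) ^ (-γ)) ^ n := by
    rw [← sq_rpow_eq_mul_rpow hV, ← prod_prod_erase_abs_sub,
      ← finsetProd_rpow _ _ fun i _ => (hDpos i).le, ← Fin.prod_const, ← prod_mul_distrib]
    refine prod_congr rfl fun i _ => ?_
    rw [one_div_div, div_rpow (hDpos i).le (by positivity), rpow_neg (by positivity)]
    ring
  have h2 : exp (a * ∑ i, y i ^ 2) * exp (-a * ∑ i, y i ^ 2) = 1 := by
    rw [← exp_add]
    simp
  rw [h1]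
  linear_combination (-(absVandermonde y * absVandermonde y ^ (2 * γ - 1) *
    (Gamma γ * (2 * a) ^ (-γ)) ^ n * √(π / a))) * h2

/-- The Dixon–Anderson integral: integrating out the inner points of an interlacing pair. -/
lemma lintegral_interlaces_left {n : ℕ} {x : Fin (n + 1) → ℝ} (hx : StrictMono x) {γ : ℝ}
    (hγ : 0 < γ) :
    ENNReal.ofReal (Gamma ((n + 1) * γ)) * ∫⁻ y in {y : Fin n → ℝ | Interlaces y x},
        ENNReal.ofReal (absVandermonde y * crossProd y x ^ (γ - 1)) =
      ENNReal.ofReal (Gamma γ ^ (n + 1) * absVandermonde x ^ (2 * γ - 1)) := by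
  set D : Fin (n + 1) → ℝ := fun i => ∏ k ∈ univ.erase i, |x i - x k| with hD
  have hDpos (i : Fin (n + 1)) : 0 < D i := prod_erase_abs_sub_pos hx.injective i
  have hV : 0 < absVandermonde x := absVandermonde_pos hx.injective
  set g : (Fin (n + 1) → ℝ) → ENNReal := fun v => ∏ i, gammaWeight γ (1 / D i) (v i) with hg
  have htotal : ∫⁻ v, g v = ENNReal.ofReal (∏ i, (D i ^ γ * Gamma γ)) := by
    have hG := Gamma_pos_of_pos hγ
    rw [lintegral_fin_prod fun i => measurable_gammaWeight _ _,
      ENNReal.ofReal_prod_of_nonneg fun i _ => by have := hDpos i; positivity]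
    refine prod_congr rfl fun i _ => ?_
    rw [lintegral_gammaWeight hγ (one_div_pos.2 (hDpos i)), one_div_one_div]
  set S : Set (Fin (n + 1) → ℝ) :=
    {z | Interlaces (Fin.init z : Fin n → ℝ) x ∧ 0 < z (Fin.last n)} with hS
  have hinit : Measurable fun z : Fin (n + 1) → ℝ => (Fin.init z : Fin n → ℝ) :=
    measurable_pi_lambda _ fun i => measurable_pi_apply _
  have hSm : MeasurableSet S := by
    exact (hinit (measurableSet_setOf_interlaces_left x)).inter
      (measurableSet_lt measurable_const (measurable_pi_apply _))
  have himage : ∫⁻ v in scaledNodeValues x '' S, g v = ∫⁻ v, g v := by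
    rw [image_scaledNodeValues hx, ← lintegral_indicator, Set.indicator_eq_self.2]
    · intro v hv i
      exact pos_of_gammaWeight_ne_zero (prod_ne_zero_iff.1 hv i (mem_univ i))
    · rw [Set.ofPred_forall]
      exact MeasurableSet.iInter fun i => measurableSet_lt measurable_const (measurable_pi_apply _)
  have hchange := lintegral_image_scaledNodeValues hSm
    (fun z hz => hz.1.strictMono_left.injective) (injOn_scaledNodeValues x) g
  rw [himage, htotal, ← lintegral_indicator hSm] at hchange
  set F : (Fin n → ℝ) → ENNReal := {y : Fin n → ℝ | Interlaces y x}.indicator fun y =>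
    ENNReal.ofReal (absVandermonde y * crossProd y x ^ (γ - 1)) with hF
  have hFm : Measurable F := by
    refine Measurable.indicator ?_ (measurableSet_setOf_interlaces_left x)
    have : Continuous fun y : Fin n → ℝ => crossProd y x :=
      (continuous_crossProd n (n + 1)).comp (by fun_prop : Continuous fun y => (y, x))
    fun_prop
  have hintegrand (z : Fin (n + 1) → ℝ) :
      S.indicator (fun z => ENNReal.ofReal (|z (Fin.last n)| ^ n *
        (absVandermonde x * absVandermonde (Fin.init z : Fin n → ℝ))) *
          g (scaledNodeValues x z)) z =
      ENNReal.ofReal (absVandermonde x) * (F (Fin.init z) *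
        gammaWeight ((n + 1) * γ) 1 (z (Fin.last n))) := by
    by_cases hz : z ∈ S
    · obtain ⟨hy, ht⟩ := hz
      set y : Fin n → ℝ := Fin.init z
      set t := z (Fin.last n)
      have hnode (j : Fin (n + 1)) : scaledNodeValues x z j = t * ∏ i, |x j - y i| := by
        rw [← abs_prod, ← neg_one_pow_mul_eq_abs (hy.prod_left_pos j), mul_left_comm]
        rfl
      have hpos (j : Fin (n + 1)) : 0 < t * ∏ i, |x j - y i| :=
        mul_pos ht (prod_pos fun i _ => abs_pos.2 (sub_ne_zero.2 (hy.ne i j).symm))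
      have hY := absVandermonde_nonneg y
      have hC := hy.crossProd_pos
      rw [Set.indicator_of_mem (show z ∈ S from ⟨hy, ht⟩), hF,
        Set.indicator_of_mem (show y ∈ {y | Interlaces y x} from hy), gammaWeight_of_pos ht]
      simp only [hg, hnode]
      rw [prod_gammaWeight hpos, ← ENNReal.ofReal_mul (by positivity),
        ← ENNReal.ofReal_mul (by positivity), ← ENNReal.ofReal_mul (by positivity)]
      congr 1
      have hsum : ∑ j, 1 / D j * (t * ∏ i, |x j - y i|) = t := by
        rw [← hy.sum_div_eq ht]
        exact sum_congr rfl fun j _ => by rw [one_div_mul_eq_div, hy.sum_div_eq ht]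
      have hprod : ∏ j, (t * ∏ i, |x j - y i|) = t ^ (n + 1) * crossProd y x := by
        rw [prod_mul_distrib, Fin.prod_const, crossProd, prod_comm]
        simp_rw [abs_sub_comm]
      have hpow : t ^ ((n + 1) * γ - 1) = t ^ n * (t ^ (n + 1)) ^ (γ - 1) := by
        rw [← rpow_natCast_mul ht.le, ← rpow_natCast, ← rpow_add ht]
        congr 1
        push_cast
        ring
      rw [hsum, hprod, mul_rpow (by positivity) hC.le, abs_of_pos ht, hpow, one_mul]
      ring
    · rw [Set.indicator_of_notMem hz]
      by_cases hy : Interlaces (Fin.init z : Fin n → ℝ) x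
      · have ht : z (Fin.last n) ∉ Set.Ioi (0 : ℝ) := fun ht => hz ⟨hy, ht⟩
        rw [gammaWeight, Set.indicator_of_notMem ht]
        simp
      · rw [hF, Set.indicator_of_notMem (show Fin.init z ∉ {y | Interlaces y x} from hy)]
        simp
  simp_rw [hintegrand] at hchange
  rw [lintegral_const_mul' _ _ ENNReal.ofReal_ne_top, lintegral_fin_snoc (by fun_prop)] at hchange
  simp_rw [Fin.init_snoc, Fin.snoc_last] at hchange
  have hgamma := lintegral_gammaWeight (c := (n + 1) * γ) (r := 1) (by positivity) one_pos
  rw [div_one, one_rpow, one_mul] at hgamma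
  simp_rw [lintegral_const_mul _ (measurable_gammaWeight _ _), hgamma] at hchange
  rw [lintegral_mul_const _ hFm, hF,
    lintegral_indicator (measurableSet_setOf_interlaces_left x)] at hchange
  rw [← ENNReal.mul_right_inj (a := ENNReal.ofReal (absVandermonde x)) (by simpa using hV)
    ENNReal.ofReal_ne_top, mul_comm (ENNReal.ofReal (Gamma _)), ← hchange,
    ← ENNReal.ofReal_mul hV.le]
  congr 1
  rw [prod_mul_distrib, finsetProd_rpow _ _ fun i _ => (hDpos i).le, prod_prod_erase_abs_sub,
    sq_rpow_eq_mul_rpow hV, Fin.prod_const]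
  ring

/-- The weight in Mehta's integral. -/
noncomputable def mehtaWeight {n : ℕ} (a γ : ℝ) (x : Fin n → ℝ) : ℝ :=
  exp (-a * ∑ i, x i ^ 2) * absVandermonde x ^ (2 * γ)

lemma mehtaWeight_nonneg {n : ℕ} (a γ : ℝ) (x : Fin n → ℝ) : 0 ≤ mehtaWeight a γ x :=
  mul_nonneg (exp_nonneg _) (rpow_nonneg (absVandermonde_nonneg x) _)

@[fun_prop]
lemma measurable_mehtaWeight (n : ℕ) (a γ : ℝ) :
    Measurable fun x : Fin n → ℝ => mehtaWeight a γ x := by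
  unfold mehtaWeight
  fun_prop

lemma mehtaWeight_eq_mul {n : ℕ} (a γ : ℝ) {x : Fin n → ℝ} (hx : StrictMono x) :
    mehtaWeight a γ x =
      absVandermonde x * (exp (-a * ∑ i, x i ^ 2) * absVandermonde x ^ (2 * γ - 1)) := by
  have hV := absVandermonde_pos hx.injective
  rw [mehtaWeight, rpow_sub_one hV.ne']
  field_simp

lemma lintegral_mehtaWeight_strictMono_succ (n : ℕ) {a γ : ℝ} (ha : 0 < a) (hγ : 0 < γ) :
    ENNReal.ofReal (Gamma γ ^ (n + 1)) *
        ∫⁻ x in {x : Fin (n + 1) → ℝ | StrictMono x}, ENNReal.ofReal (mehtaWeight a γ x) =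
      ENNReal.ofReal (Gamma ((n + 1) * γ)) *
        (ENNReal.ofReal (√(π / a) * (Gamma γ * (2 * a) ^ (-γ)) ^ n) *
          ∫⁻ y in {y : Fin n → ℝ | StrictMono y}, ENNReal.ofReal (mehtaWeight a γ y)) := by
  set G : (Fin n → ℝ) → (Fin (n + 1) → ℝ) → ENNReal := fun y x =>
    {p : (Fin n → ℝ) × (Fin (n + 1) → ℝ) | Interlaces p.1 p.2}.indicator
      (fun p => ENNReal.ofReal (absVandermonde p.1 * (absVandermonde p.2 *
        exp (-a * ∑ j, p.2 j ^ 2) * crossProd p.1 p.2 ^ (γ - 1)))) (y, x) with hG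
  have hGm : Measurable (Function.uncurry G) := by
    refine Measurable.indicator (ENNReal.measurable_ofReal.comp ?_)
      (isOpen_setOf_interlaces n).measurableSet
    have h1 : Continuous fun p : (Fin n → ℝ) × (Fin (n + 1) → ℝ) => absVandermonde p.1 :=
      (continuous_absVandermonde n).comp continuous_fst
    have h2 : Continuous fun p : (Fin n → ℝ) × (Fin (n + 1) → ℝ) => absVandermonde p.2 :=
      (continuous_absVandermonde _).comp continuous_snd
    fun_prop
  have hGγ : 0 < Gamma γ := Gamma_pos_of_pos hγ
  have hleft (y : Fin n → ℝ) : ∫⁻ x, G y x = {y : Fin n → ℝ | StrictMono y}.indicator (fun y =>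
      ENNReal.ofReal (√(π / a) * (Gamma γ * (2 * a) ^ (-γ)) ^ n) *
        ENNReal.ofReal (mehtaWeight a γ y)) y := by
    have h : ∫⁻ x, G y x = ∫⁻ x in {x | Interlaces y x}, ENNReal.ofReal (absVandermonde y) *
        ENNReal.ofReal (absVandermonde x * exp (-a * ∑ j, x j ^ 2) * crossProd y x ^ (γ - 1)) := by
      rw [← lintegral_indicator (measurableSet_setOf_interlaces_right y)]
      simp_rw [← ENNReal.ofReal_mul (absVandermonde_nonneg y)]
      rfl
    by_cases hy : StrictMono y
    · rw [h, lintegral_const_mul' _ _ ENNReal.ofReal_ne_top, lintegral_interlaces_gaussian hy ha hγ,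
        Set.indicator_of_mem (show y ∈ {y | StrictMono y} from hy), mehtaWeight_eq_mul a γ hy,
        ← ENNReal.ofReal_mul (absVandermonde_nonneg y), ← ENNReal.ofReal_mul (by positivity)]
      congr 1
      ring
    · rw [h, Set.indicator_of_notMem (show y ∉ {y | StrictMono y} from hy),
        Set.eq_empty_of_forall_notMem (s := {x | Interlaces y x})
          fun x (hx : Interlaces y x) => hy hx.strictMono_left]
      simp
  have hright (x : Fin (n + 1) → ℝ) : ENNReal.ofReal (Gamma ((n + 1) * γ)) * ∫⁻ y, G y x =
      {x : Fin (n + 1) → ℝ | StrictMono x}.indicator (fun x =>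
        ENNReal.ofReal (Gamma γ ^ (n + 1)) * ENNReal.ofReal (mehtaWeight a γ x)) x := by
    have hE : 0 ≤ absVandermonde x * exp (-a * ∑ j, x j ^ 2) :=
      mul_nonneg (absVandermonde_nonneg x) (exp_nonneg _)
    have h : ∫⁻ y, G y x = ∫⁻ y in {y : Fin n → ℝ | Interlaces y x},
        ENNReal.ofReal (absVandermonde x * exp (-a * ∑ j, x j ^ 2)) *
          ENNReal.ofReal (absVandermonde y * crossProd y x ^ (γ - 1)) := by
      rw [← lintegral_indicator (measurableSet_setOf_interlaces_left x)]
      simp_rw [← ENNReal.ofReal_mul hE, mul_left_comm _ (absVandermonde _)]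
      rfl
    by_cases hx : StrictMono x
    · rw [h, lintegral_const_mul' _ _ ENNReal.ofReal_ne_top, mul_left_comm,
        lintegral_interlaces_left hx hγ,
        Set.indicator_of_mem (show x ∈ {x | StrictMono x} from hx), mehtaWeight_eq_mul a γ hx,
        ← ENNReal.ofReal_mul hE, ← ENNReal.ofReal_mul (by positivity)]
      congr 1
      ring
    · rw [h, Set.indicator_of_notMem (show x ∉ {x | StrictMono x} from hx),
        Set.eq_empty_of_forall_notMem (s := {y : Fin n → ℝ | Interlaces y x})
          fun y (hy : Interlaces y x) => hx hy.strictMono_right]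
      simp
  have hswap := lintegral_lintegral_swap (μ := volume) (ν := volume) hGm.aemeasurable
  simp_rw [hleft] at hswap
  rw [← lintegral_const_mul' _ _ ENNReal.ofReal_ne_top,
    ← lintegral_const_mul' _ _ ENNReal.ofReal_ne_top,
    ← lintegral_indicator (measurableSet_setOf_strictMono _),
    ← lintegral_indicator (measurableSet_setOf_strictMono _), hswap,
    ← lintegral_const_mul' _ _ ENNReal.ofReal_ne_top]
  exact lintegral_congr fun x => (hright x).symm

/-- A symmetric function vanishing on the diagonals is determined by its restriction to the
Weyl chamber. -/
lemma lintegral_eq_factorial_mul_lintegral_strictMono {n : ℕ} {F : (Fin n → ℝ) → ENNReal}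
    (hF : Measurable F) (hsymm : ∀ (σ : Equiv.Perm (Fin n)) x, F (x ∘ σ) = F x)
    (hdiag : ∀ x, ¬ Function.Injective x → F x = 0) :
    ∫⁻ x, F x = n.factorial * ∫⁻ x in {x : Fin n → ℝ | StrictMono x}, F x := by
  classical
  set H : (Fin n → ℝ) → ENNReal := {x : Fin n → ℝ | StrictMono x}.indicator F with hH
  have hHm : Measurable H := hF.indicator (measurableSet_setOf_strictMono n)
  have hsum (x : Fin n → ℝ) : F x = ∑ σ : Equiv.Perm (Fin n), H (x ∘ σ) := by
    by_cases hx : Function.Injective x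
    · have hs : StrictMono (x ∘ Tuple.sort x) :=
        (Tuple.monotone_sort x).strictMono_of_injective (hx.comp (Equiv.injective _))
      rw [sum_eq_single (Tuple.sort x), hH,
        Set.indicator_of_mem (show x ∘ Tuple.sort x ∈ {x | StrictMono x} from hs), hsymm]
      · intro σ _ hσ
        refine Set.indicator_of_notMem (fun (h : StrictMono (x ∘ σ)) => hσ ?_) _
        have := Tuple.unique_monotone h.monotone hs.monotone
        exact Equiv.ext fun i => hx (congrFun this i)
      · simp
    · rw [hdiag x hx, sum_eq_zero]
      intro σ _
      refine Set.indicator_of_notMem (fun (h : StrictMono (x ∘ σ)) => hx ?_) _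
      simpa using h.injective
  have hperm (σ : Equiv.Perm (Fin n)) : ∫⁻ x, H (x ∘ σ) = ∫⁻ x, H x := by
    have h := (volume_measurePreserving_piCongrLeft (fun _ : Fin n => ℝ) σ.symm).lintegral_comp hHm
    rw [← h]
    refine lintegral_congr fun x => congrArg H (funext fun i => ?_)
    exact (MeasurableEquiv.piCongrLeft_apply_apply (β := fun _ => ℝ) σ.symm x (σ i)).symm.trans
      (by simp)
  rw [lintegral_congr hsum, lintegral_finsetSum _ fun σ _ => by fun_prop]
  simp_rw [hperm]
  rw [sum_const, card_univ, Fintype.card_perm, Fintype.card_fin, nsmul_eq_mul, hH,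
    lintegral_indicator (measurableSet_setOf_strictMono n)]

lemma absVandermonde_comp_perm {n : ℕ} (σ : Equiv.Perm (Fin n)) (x : Fin n → ℝ) :
    absVandermonde (x ∘ σ) = absVandermonde x := by
  have : Matrix.vandermonde (x ∘ σ) = (Matrix.vandermonde x).submatrix σ id := by
    ext i j
    simp [Matrix.vandermonde_apply]
  rw [← abs_det_vandermonde, ← abs_det_vandermonde, this, Matrix.det_permute]
  rcases Int.units_eq_one_or (Equiv.Perm.sign σ) with h | h <;> simp [h]

lemma mehtaWeight_comp_perm {n : ℕ} (a γ : ℝ) (σ : Equiv.Perm (Fin n)) (x : Fin n → ℝ) :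
    mehtaWeight a γ (x ∘ σ) = mehtaWeight a γ x := by
  simp only [mehtaWeight, absVandermonde_comp_perm, Function.comp_apply]
  rw [Equiv.sum_comp σ fun i => x i ^ 2]

lemma mehtaWeight_eq_zero {n : ℕ} {a γ : ℝ} (hγ : 0 < γ) {x : Fin n → ℝ}
    (hx : ¬ Function.Injective x) : mehtaWeight a γ x = 0 := by
  have h : (Matrix.vandermonde x).det = 0 :=
    not_not.1 fun h => hx (Matrix.det_vandermonde_ne_zero_iff.1 h)
  rw [mehtaWeight, ← abs_det_vandermonde, h, abs_zero, zero_rpow (by positivity), mul_zero]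

/-- The closed form of Mehta's integral. -/
noncomputable def mehtaValue (n : ℕ) (a γ : ℝ) : ℝ :=
  (2 * π) ^ ((n : ℝ) / 2) * (2 * a) ^ (-(n * (γ * (n - 1) + 1)) / 2) *
    ∏ i ∈ Icc 1 n, Gamma (1 + i * γ) / Gamma (1 + γ)

lemma mehtaValue_nonneg (n : ℕ) {a γ : ℝ} (ha : 0 < a) (hγ : 0 < γ) : 0 ≤ mehtaValue n a γ := by
  have h (i : ℕ) : 0 < Gamma (1 + i * γ) := Gamma_pos_of_pos (by positivity)
  have h' : 0 < Gamma (1 + γ) := Gamma_pos_of_pos (by positivity)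
  exact mul_nonneg (by positivity) (prod_nonneg fun i _ => (div_pos (h i) h').le)

lemma mehtaValue_succ (n : ℕ) {a γ : ℝ} (ha : 0 < a) (hγ : 0 < γ) :
    Gamma γ ^ (n + 1) * mehtaValue (n + 1) a γ =
      (n + 1) * (Gamma ((n + 1) * γ) *
        (√(π / a) * (Gamma γ * (2 * a) ^ (-γ)) ^ n * mehtaValue n a γ)) := by
  have hG : 0 < Gamma γ := Gamma_pos_of_pos hγ
  have h2a : 0 < 2 * a := by positivity
  have h1 : (2 * π) ^ (((n + 1 : ℕ) : ℝ) / 2) = (2 * π) ^ ((n : ℝ) / 2) * √(2 * π) := by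
    rw [sqrt_eq_rpow, ← rpow_add (by positivity)]
    congr 1
    push_cast
    ring
  have h2 : (2 * a) ^ (-((n + 1 : ℕ) * (γ * ((n + 1 : ℕ) - 1) + 1)) / 2) =
      (2 * a) ^ (-(n * (γ * (n - 1) + 1)) / 2) * ((2 * a) ^ (-γ)) ^ n / √(2 * a) := by
    rw [sqrt_eq_rpow, ← rpow_mul_natCast h2a.le, ← rpow_add h2a, ← rpow_sub h2a]
    congr 1
    push_cast
    ring
  have h3 : √(π / a) = √(2 * π) / √(2 * a) := by
    rw [← sqrt_div (by positivity), mul_div_mul_left _ _ two_ne_zero]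
  have h4 : Gamma (1 + (n + 1 : ℕ) * γ) / Gamma (1 + γ) =
      (n + 1) * Gamma ((n + 1) * γ) / Gamma γ := by
    rw [add_comm, add_comm 1 γ, Gamma_add_one (by positivity), Gamma_add_one hγ.ne']
    push_cast
    field_simp
  rw [mehtaValue, mehtaValue, prod_Icc_succ_top (by omega), h1, h2, h3, h4, mul_pow]
  field_simp
  ring

lemma factorial_mul_lintegral_mehtaWeight_strictMono (n : ℕ) {a γ : ℝ} (ha : 0 < a)
    (hγ : 0 < γ) :
    n.factorial * ∫⁻ x in {x : Fin n → ℝ | StrictMono x}, ENNReal.ofReal (mehtaWeight a γ x) =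
      ENNReal.ofReal (mehtaValue n a γ) := by
  have hG : 0 < Gamma γ := Gamma_pos_of_pos hγ
  induction n with
  | zero =>
    have : {x : Fin 0 → ℝ | StrictMono x} = Set.univ :=
      Set.eq_univ_of_forall fun x i => i.elim0
    rw [this]
    simp [mehtaWeight, mehtaValue, absVandermonde, volume_pi]
  | succ n ih =>
    have hG' : 0 < Gamma ((n + 1) * γ) := Gamma_pos_of_pos (by positivity)
    rw [← ENNReal.mul_right_inj (a := ENNReal.ofReal (Gamma γ ^ (n + 1)))
      (by simpa using pow_pos hG _) ENNReal.ofReal_ne_top, mul_left_comm,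
      lintegral_mehtaWeight_strictMono_succ n ha hγ, ← ENNReal.ofReal_mul (pow_nonneg hG.le _),
      mehtaValue_succ n ha hγ, ENNReal.ofReal_mul (p := (n : ℝ) + 1) (by positivity),
      ENNReal.ofReal_mul hG'.le,
      ENNReal.ofReal_mul (p := √(π / a) * (Gamma γ * (2 * a) ^ (-γ)) ^ n) (by positivity), ← ih,
      Nat.factorial_succ]
    have : ENNReal.ofReal (n + 1) = ((n + 1 : ℕ) : ENNReal) := by
      rw [← ENNReal.ofReal_natCast]
      norm_cast
    rw [this]
    push_cast
    ring

/-- Mehta's integral: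
`∫_{ℝ^N} e^{-a|u|²} ∏_{i<j} |u_j - u_i|^{2γ} du
  = (2π)^{N/2} (2a)^{-N(γ(N-1)+1)/2} ∏_{i=1}^N Γ(1+iγ)/Γ(1+γ)`. -/
theorem mehta_integral (N : ℕ) (a γ : ℝ) (ha : 0 < a) (hγ : 0 < γ) :
    ∫ u : Fin N → ℝ,
        Real.exp (-a * ∑ i, u i ^ 2) *
          ∏ i : Fin N, ∏ j ∈ Finset.Ioi i, |u j - u i| ^ (2 * γ) =
      (2 * π) ^ ((N : ℝ) / 2) *
        (2 * a) ^ (-(N * (γ * (N - 1) + 1)) / 2) *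
        ∏ i ∈ Finset.Icc 1 N, Real.Gamma (1 + i * γ) / Real.Gamma (1 + γ) := by
  have hweight (u : Fin N → ℝ) : exp (-a * ∑ i, u i ^ 2) *
      ∏ i : Fin N, ∏ j ∈ Ioi i, |u j - u i| ^ (2 * γ) = mehtaWeight a γ u := by
    rw [mehtaWeight, absVandermonde,
      ← finsetProd_rpow _ _ fun i _ => prod_nonneg fun j _ => abs_nonneg _]
    simp_rw [finsetProd_rpow _ _ fun _ _ => abs_nonneg _]
  simp_rw [hweight]
  rw [integral_eq_lintegral_of_nonneg_ae (ae_of_all _ (mehtaWeight_nonneg a γ))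
      (by fun_prop), lintegral_eq_factorial_mul_lintegral_strictMono (by fun_prop)
      (fun σ x => by rw [mehtaWeight_comp_perm])
      (fun x hx => by rw [mehtaWeight_eq_zero hγ hx, ENNReal.ofReal_zero]),
    factorial_mul_lintegral_mehtaWeight_strictMono N ha hγ,
    ENNReal.toReal_ofReal (mehtaValue_nonneg N ha hγ), mehtaValue]
end

section
/- For γ > 0 and a > 0, ∫_{ℝ^N} e^{-|u|²/2} ∏_{1≤i<j≤N} |u_j² - u_i²|^{2γ} ∏_{j=1}^N |u_j|^{2a-1} du = 2^{aN + γN(N-1)} ∏_{j=1}^N Γ(1+jγ)Γ(a+γ(j-1))/Γ(1+γ). -/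
open Finset Real MeasureTheory

/-- The even weight `|u|^(2a-1) e^(-u²/2)` on the real line. -/
noncomputable def radialWeight (a u : ℝ) : ℝ := |u| ^ (2 * a - 1) * Real.exp (-u ^ 2 / 2)

lemma radialWeight_nonneg (a u : ℝ) : 0 ≤ radialWeight a u := by
  unfold radialWeight; positivity

lemma radialWeight_abs (a u : ℝ) : radialWeight a |u| = radialWeight a u := by
  simp [radialWeight]

lemma measurable_radialWeight (a : ℝ) : Measurable (radialWeight a) := by
  unfold radialWeight; fun_prop

lemma abs_rpow_mul_radialWeight {a b u : ℝ} (hu : u ≠ 0) :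
    |u| ^ (2 * b) * radialWeight a u = radialWeight (a + b) u := by
  unfold radialWeight
  rw [← mul_assoc, ← Real.rpow_add (abs_pos.2 hu)]
  ring_nf

lemma sq_mul_radialWeight {a : ℝ} (ha : 0 < a) (u : ℝ) :
    u ^ 2 * radialWeight a u = radialWeight (a + 1) u := by
  rcases eq_or_ne u 0 with rfl | hu
  · simp [radialWeight, Real.zero_rpow (by linarith : 2 * (a + 1) - 1 ≠ 0)]
  · rw [← abs_rpow_mul_radialWeight hu, mul_one, Real.rpow_two, sq_abs]

lemma integrable_radialWeight {a : ℝ} (ha : 0 < a) : Integrable (radialWeight a) := by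
  have h : IntegrableOn (fun x : ℝ => x ^ (2 * a - 1) * Real.exp (-(1 / 2) * x ^ 2)) (Set.Ioi 0) :=
    integrableOn_rpow_mul_exp_neg_mul_sq (by norm_num) (by linarith)
  have h' : IntegrableOn (radialWeight a) (Set.Ioi 0) := by
    refine h.congr_fun (fun x hx => ?_) measurableSet_Ioi
    simp only [radialWeight, abs_of_pos (Set.mem_Ioi.1 hx)]
    ring_nf
  rw [← integrableOn_univ, ← Set.Iio_union_Ici (a := (0 : ℝ)), integrableOn_union,
    integrableOn_Ici_iff_integrableOn_Ioi]
  refine ⟨?_, h'⟩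
  rw [← (Measure.measurePreserving_neg (volume : Measure ℝ)).integrableOn_comp_preimage
      (Homeomorph.neg ℝ).measurableEmbedding]
  have : radialWeight a ∘ Neg.neg = radialWeight a := by
    ext u; simp [radialWeight]
  simpa [this] using h'

lemma integrable_one_add_sq_pow_mul_radialWeight (n : ℕ) {a : ℝ} (ha : 0 < a) :
    Integrable (fun u => (1 + u ^ 2) ^ n * radialWeight a u) := by
  induction n generalizing a with
  | zero => simpa using integrable_radialWeight ha
  | succ n ih =>
    refine ((ih ha).add (ih (by linarith : 0 < a + 1))).congr (.of_forall fun u => ?_)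
    simp only [Pi.add_apply, ← sq_mul_radialWeight ha]
    ring

lemma integrable_mul_radialWeight {a C : ℝ} (ha : 0 < a) {n : ℕ} {f : ℝ → ℝ} (hf : Measurable f)
    (hb : ∀ u, |f u| ≤ C * (1 + u ^ 2) ^ n) : Integrable (fun u => f u * radialWeight a u) := by
  refine ((integrable_one_add_sq_pow_mul_radialWeight n ha).const_mul C).mono'
    (hf.mul (measurable_radialWeight a)).aestronglyMeasurable (.of_forall fun u => ?_)
  rw [Real.norm_eq_abs, abs_mul, abs_of_nonneg (radialWeight_nonneg a u), ← mul_assoc]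
  exact mul_le_mul_of_nonneg_right (hb u) (radialWeight_nonneg a u)

lemma integral_eq_two_mul_integral_Ioi {f : ℝ → ℝ} (hf : ∀ u, f |u| = f u) :
    ∫ u, f u = 2 * ∫ u in Set.Ioi 0, f u := by
  rw [← integral_comp_abs]
  simp only [hf]

lemma hasDerivAt_exp_neg_sq_div_two (u : ℝ) :
    HasDerivAt (fun u : ℝ => Real.exp (-u ^ 2 / 2)) (Real.exp (-u ^ 2 / 2) * (-u)) u :=
  HasDerivAt.exp (((hasDerivAt_pow 2 u).neg.div_const 2).congr_deriv (by simp; ring))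

section IntegrationByParts

variable {C : ℝ} {n : ℕ} {g h : ℝ → ℝ}

/-- Integration by parts against `radialWeight a` for an even function `g` with
`g' u = u * h u`. -/
lemma integral_radialWeight_stein {a : ℝ} (ha : 0 < a) (hg : ∀ u, HasDerivAt g (u * h u) u)
    (hm : Measurable h) (hge : ∀ u, g |u| = g u) (hhe : ∀ u, h |u| = h u)
    (hgb : ∀ u, |g u| ≤ C * (1 + u ^ 2) ^ n) (hhb : ∀ u, |h u| ≤ C * (1 + u ^ 2) ^ n) :
    ∫ u, (2 * a * g u + u ^ 2 * h u - u ^ 2 * g u) * radialWeight a u = 0 := by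
  have hgc : Continuous g := continuous_iff_continuousAt.2 fun u => (hg u).continuousAt
  have hsq : ∀ f : ℝ → ℝ, Measurable f → (∀ u, |f u| ≤ C * (1 + u ^ 2) ^ n) →
      Integrable (fun u => u ^ 2 * f u * radialWeight a u) := by
    intro f hf hfb
    refine (integrable_mul_radialWeight (by linarith : 0 < a + 1) hf hfb).congr
      (.of_forall fun u => ?_)
    simp only [← sq_mul_radialWeight ha]
    ring
  have hint : Integrable
      (fun u => (2 * a * g u + u ^ 2 * h u - u ^ 2 * g u) * radialWeight a u) := by
    refine ((((integrable_mul_radialWeight ha hgc.measurable hgb).const_mul (2 * a)).add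
      (hsq h hm hhb)).sub (hsq g hgc.measurable hgb)).congr (.of_forall fun u => ?_)
    simp only [Pi.add_apply, Pi.sub_apply]
    ring
  have hint' : Integrable (fun u => g u * radialWeight (a + 1 / 2) u) :=
    integrable_mul_radialWeight (by linarith) hgc.measurable hgb
  have hderiv : ∀ u ∈ Set.Ioi (0 : ℝ), HasDerivAt
      (fun u => g u * (u ^ (2 * a) * Real.exp (-u ^ 2 / 2)))
      ((2 * a * g u + u ^ 2 * h u - u ^ 2 * g u) * radialWeight a u) u := by
    intro u hu
    have hu : 0 < u := hu
    have h1 : HasDerivAt (fun u : ℝ => u ^ (2 * a)) (2 * a * u ^ (2 * a - 1)) u :=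
      Real.hasDerivAt_rpow_const (Or.inl hu.ne')
    have h2 := hasDerivAt_exp_neg_sq_div_two u
    refine ((hg u).mul (h1.mul h2)).congr_deriv ?_
    have h3 : u ^ (2 * a) = u * u ^ (2 * a - 1) := by
      rw [← Real.rpow_one_add' hu.le (by linarith)]; ring_nf
    simp only [radialWeight, abs_of_pos hu, Pi.mul_apply, h3]
    ring
  have hlim := tendsto_zero_of_hasDerivAt_of_integrableOn_Ioi hderiv hint.integrableOn
    (hint'.integrableOn.congr_fun (fun u hu => by
      simp only [radialWeight, abs_of_pos (Set.mem_Ioi.1 hu)]; ring_nf) measurableSet_Ioi)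
  rw [integral_eq_two_mul_integral_Ioi (fun u => by simp only [hge, hhe, radialWeight_abs, sq_abs]),
    integral_Ioi_of_hasDerivAt_of_tendsto ?_ hderiv hint.integrableOn hlim]
  · simp [Real.zero_rpow (by positivity : 2 * a ≠ 0)]
  · refine ContinuousAt.continuousWithinAt ?_
    exact hgc.continuousAt.mul ((Real.continuousAt_rpow_const _ _ (Or.inr (by positivity))).mul
      (by fun_prop))

/-- The boundary case `a = 1` of integration by parts against `radialWeight`. -/
lemma integral_radialWeight_one_boundary (hg : ∀ u, HasDerivAt g (u * h u) u)
    (hm : Measurable h) (hge : ∀ u, g |u| = g u) (hhe : ∀ u, h |u| = h u)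
    (hgb : ∀ u, |g u| ≤ C * (1 + u ^ 2) ^ n) (hhb : ∀ u, |h u| ≤ C * (1 + u ^ 2) ^ n) :
    ∫ u, (h u - g u) * radialWeight 1 u = -2 * g 0 := by
  have hgc : Continuous g := continuous_iff_continuousAt.2 fun u => (hg u).continuousAt
  have hint : Integrable (fun u => (h u - g u) * radialWeight 1 u) := by
    refine ((integrable_mul_radialWeight one_pos hm hhb).sub
      (integrable_mul_radialWeight one_pos hgc.measurable hgb)).congr (.of_forall fun u => ?_)
    simp only [Pi.sub_apply]
    ring
  have hint' : Integrable (fun u => g u * radialWeight (1 / 2) u) :=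
    integrable_mul_radialWeight (by norm_num) hgc.measurable hgb
  have hderiv : ∀ u ∈ Set.Ioi (0 : ℝ), HasDerivAt
      (fun u => g u * Real.exp (-u ^ 2 / 2)) ((h u - g u) * radialWeight 1 u) u := by
    intro u hu
    have hu : 0 < u := hu
    have h2 := hasDerivAt_exp_neg_sq_div_two u
    refine ((hg u).mul h2).congr_deriv ?_
    have : (2 : ℝ) * 1 - 1 = 1 := by norm_num
    simp only [radialWeight, abs_of_pos hu, this, Real.rpow_one]
    ring
  have hlim := tendsto_zero_of_hasDerivAt_of_integrableOn_Ioi hderiv hint.integrableOn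
    (hint'.integrableOn.congr_fun (fun u hu => by
      simp [radialWeight]) measurableSet_Ioi)
  rw [integral_eq_two_mul_integral_Ioi (fun u => by simp only [hge, hhe, radialWeight_abs]),
    integral_Ioi_of_hasDerivAt_of_tendsto ?_ hderiv hint.integrableOn hlim]
  · simp
  · exact (by fun_prop : Continuous fun u => g u * Real.exp (-u ^ 2 / 2)).continuousWithinAt

end IntegrationByParts

/-- The regularised squared distance `(x² - y²)² + ε²` between the squares of `x` and `y`. -/
def pairGap (ε x y : ℝ) : ℝ := (x ^ 2 - y ^ 2) ^ 2 + ε ^ 2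

lemma pairGap_nonneg (ε x y : ℝ) : 0 ≤ pairGap ε x y := by unfold pairGap; positivity

lemma pairGap_pos {ε : ℝ} (hε : 0 < ε) (x y : ℝ) : 0 < pairGap ε x y := by
  unfold pairGap; positivity

lemma pairGap_comm (ε x y : ℝ) : pairGap ε x y = pairGap ε y x := by
  unfold pairGap; ring

lemma pairGap_le {ε : ℝ} (hε : 0 ≤ ε) (hε1 : ε ≤ 1) (x y : ℝ) :
    pairGap ε x y ≤ ((1 + x ^ 2) * (1 + y ^ 2)) ^ 2 := by
  unfold pairGap
  nlinarith [sq_nonneg (x * y), sq_nonneg x, sq_nonneg y, mul_nonneg (sq_nonneg x) (sq_nonneg y),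
    sq_nonneg (x ^ 2 * y ^ 2), mul_nonneg (sq_nonneg x) (sq_nonneg (x * y)),
    mul_nonneg (sq_nonneg y) (sq_nonneg (x * y))]

lemma abs_sub_div_pairGap_le {ε : ℝ} (hε : 0 < ε) (x y : ℝ) :
    |(x ^ 2 - y ^ 2) / pairGap ε x y| ≤ 1 / ε := by
  rw [abs_div, abs_of_pos (pairGap_pos hε x y), div_le_div_iff₀ (pairGap_pos hε x y) hε, pairGap,
    ← sq_abs (x ^ 2 - y ^ 2)]
  nlinarith [sq_nonneg (|x ^ 2 - y ^ 2| - ε), abs_nonneg (x ^ 2 - y ^ 2),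
    mul_nonneg (abs_nonneg (x ^ 2 - y ^ 2)) hε.le]

lemma sq_div_pairGap_le_one (ε x y : ℝ) : (x ^ 2 - y ^ 2) ^ 2 / pairGap ε x y ≤ 1 :=
  div_le_one_of_le₀ (by unfold pairGap; nlinarith [sq_nonneg ε]) (pairGap_nonneg ε x y)

section Repulsion

variable {ι : Type*} [Fintype ι] [DecidableEq ι]

/-- The regularised repulsion factor `∏_{i<j} ((u_i² - u_j²)² + ε²)^γ`, written as a product over
ordered pairs. -/
noncomputable def repulsion (γ ε : ℝ) (u : ι → ℝ) : ℝ :=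
  ∏ i, ∏ j ∈ {i}ᶜ, pairGap ε (u i) (u j) ^ (γ / 2)

/-- The logarithmic derivative of `repulsion` in the direction of the `i`-th coordinate is
`u i * repulsionForce γ ε i u`. -/
noncomputable def repulsionForce (γ ε : ℝ) (i : ι) (u : ι → ℝ) : ℝ :=
  4 * γ * ∑ j ∈ {i}ᶜ, (u i ^ 2 - u j ^ 2) / pairGap ε (u i) (u j)

/-- The product `∏ (1 + u_i²)`, used to control polynomial growth. -/
def growth (u : ι → ℝ) : ℝ := ∏ i, (1 + u i ^ 2)

omit [DecidableEq ι] in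
lemma one_le_growth (u : ι → ℝ) : 1 ≤ growth u :=
  Finset.one_le_prod fun i _ => by nlinarith [sq_nonneg (u i)]

lemma repulsion_nonneg (γ ε : ℝ) (u : ι → ℝ) : 0 ≤ repulsion γ ε u :=
  prod_nonneg fun _ _ => prod_nonneg fun _ _ => Real.rpow_nonneg (pairGap_nonneg _ _ _) _

lemma continuous_repulsion {γ : ℝ} (hγ : 0 < γ) (ε : ℝ) :
    Continuous (repulsion γ ε : (ι → ℝ) → ℝ) := by
  unfold repulsion pairGap
  refine continuous_finsetProd _ fun i _ => continuous_finsetProd _ fun j _ =>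
    Continuous.rpow_const (by fun_prop) fun _ => Or.inr (by positivity)

lemma continuous_repulsion_left {γ : ℝ} (hγ : 0 < γ) (u : ι → ℝ) :
    Continuous fun ε => repulsion γ ε u := by
  unfold repulsion pairGap
  refine continuous_finsetProd _ fun i _ => continuous_finsetProd _ fun j _ =>
    Continuous.rpow_const (by fun_prop) fun _ => Or.inr (by positivity)

lemma measurable_repulsionForce (γ ε : ℝ) (i : ι) :
    Measurable (repulsionForce γ ε i : (ι → ℝ) → ℝ) := by
  unfold repulsionForce pairGap
  fun_prop

lemma pairGap_le_growth_sq {ε : ℝ} (hε : 0 ≤ ε) (hε1 : ε ≤ 1) (u : ι → ℝ) {i j : ι} (hij : i ≠ j) :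
    pairGap ε (u i) (u j) ≤ growth u ^ 2 := by
  refine (pairGap_le hε hε1 _ _).trans (pow_le_pow_left₀ (by positivity) ?_ 2)
  rw [growth, ← prod_pair (f := fun i => 1 + u i ^ 2) hij]
  exact Finset.prod_le_prod_of_subset_of_one_le (subset_univ _) (fun k _ => by positivity)
    fun k _ _ => by nlinarith [sq_nonneg (u k)]

lemma exists_repulsion_le_growth_pow (ι : Type*) [Fintype ι] [DecidableEq ι] {γ : ℝ} (hγ : 0 < γ) :
    ∃ n : ℕ, ∀ ε : ℝ, 0 ≤ ε → ε ≤ 1 → ∀ u : ι → ℝ, repulsion γ ε u ≤ growth u ^ n := by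
  obtain ⟨m, hm⟩ := exists_nat_ge γ
  refine ⟨∑ i : ι, ∑ j ∈ ({i}ᶜ : Finset ι), m, fun ε hε hε1 u => ?_⟩
  simp only [← prod_pow_eq_pow_sum, repulsion]
  have hW := one_le_growth u
  refine prod_le_prod (fun _ _ => prod_nonneg fun _ _ => Real.rpow_nonneg (pairGap_nonneg _ _ _) _)
    fun i _ => prod_le_prod (fun _ _ => Real.rpow_nonneg (pairGap_nonneg _ _ _) _) fun j hj => ?_
  have hij : i ≠ j := by simpa [eq_comm] using hj
  calc pairGap ε (u i) (u j) ^ (γ / 2) ≤ (growth u ^ 2) ^ (γ / 2) :=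
        Real.rpow_le_rpow (pairGap_nonneg _ _ _) (pairGap_le_growth_sq hε hε1 u hij) (by positivity)
    _ = growth u ^ γ := by
        rw [← Real.rpow_natCast, ← Real.rpow_mul (by linarith)]
        congr 1; push_cast; ring
    _ ≤ growth u ^ (m : ℝ) := Real.rpow_le_rpow_of_exponent_le hW hm
    _ = growth u ^ m := Real.rpow_natCast _ _

lemma repulsion_comp_perm (γ ε : ℝ) (u : ι → ℝ) (σ : Equiv.Perm ι) :
    repulsion γ ε (u ∘ σ) = repulsion γ ε u := by
  unfold repulsion
  rw [← Equiv.prod_comp σ (fun i => ∏ j ∈ {i}ᶜ, pairGap ε (u i) (u j) ^ (γ / 2))]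
  refine prod_congr rfl fun i _ => prod_equiv σ (fun j => by simp) fun j _ => rfl

lemma repulsion_congr_sq (γ ε : ℝ) {u v : ι → ℝ} (h : ∀ i, u i ^ 2 = v i ^ 2) :
    repulsion γ ε u = repulsion γ ε v := by
  simp only [repulsion, pairGap, h]

lemma repulsionForce_congr_sq (γ ε : ℝ) (i : ι) {u v : ι → ℝ} (h : ∀ i, u i ^ 2 = v i ^ 2) :
    repulsionForce γ ε i u = repulsionForce γ ε i v := by
  simp only [repulsionForce, pairGap, h]

lemma abs_repulsionForce_le {γ ε : ℝ} (hγ : 0 < γ) (hε : 0 < ε) (i : ι) (u : ι → ℝ) :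
    |repulsionForce γ ε i u| ≤ 4 * γ * (Fintype.card ι * (1 / ε)) := by
  rw [repulsionForce, abs_mul, abs_of_pos (by positivity : 0 < 4 * γ)]
  gcongr
  refine (abs_sum_le_sum_abs _ _).trans ((sum_le_card_nsmul _ _ (1 / ε) fun j _ =>
    abs_sub_div_pairGap_le hε _ _).trans ?_)
  rw [nsmul_eq_mul]
  gcongr
  exact card_le_univ _

lemma repulsion_eq_exp {ε : ℝ} (hε : 0 < ε) (γ : ℝ) (u : ι → ℝ) :
    repulsion γ ε u =
      Real.exp (∑ i, ∑ j ∈ {i}ᶜ, Real.log (pairGap ε (u i) (u j)) * (γ / 2)) := by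
  simp only [repulsion, Real.exp_sum, Real.rpow_def_of_pos (pairGap_pos hε _ _)]

lemma hasDerivAt_repulsion_update {ε : ℝ} (hε : 0 < ε) (γ : ℝ) (u : ι → ℝ) (i : ι) (x : ℝ) :
    HasDerivAt (fun x => repulsion γ ε (Function.update u i x))
      (x * (repulsionForce γ ε i (Function.update u i x) *
        repulsion γ ε (Function.update u i x))) x := by
  simp only [repulsion_eq_exp hε]
  set v := Function.update u i x with hv
  have hvi : v i = x := by simp [hv]
  have hcoord : ∀ k, HasDerivAt (fun x => Function.update u i x k)
      (Pi.single (M := fun _ => ℝ) i 1 k) x := by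
    intro k
    rcases eq_or_ne k i with rfl | hk
    · simpa using hasDerivAt_id' x
    · simpa [hk] using hasDerivAt_const x (u k)
  have hgap : ∀ k l, HasDerivAt
      (fun x => pairGap ε (Function.update u i x k) (Function.update u i x l))
      (4 * v k * (v k ^ 2 - v l ^ 2) * Pi.single (M := fun _ => ℝ) i 1 k +
        4 * v l * (v l ^ 2 - v k ^ 2) * Pi.single (M := fun _ => ℝ) i 1 l) x := by
    intro k l
    refine (((((hcoord k).fun_pow 2).fun_sub ((hcoord l).fun_pow 2)).fun_pow 2).add_const
      (ε ^ 2)).congr_deriv ?_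
    simp only [← hv]
    push_cast
    ring
  have hlog : ∀ k l, HasDerivAt
      (fun x => Real.log (pairGap ε (Function.update u i x k) (Function.update u i x l)) * (γ / 2))
      (2 * γ * v k * ((v k ^ 2 - v l ^ 2) / pairGap ε (v k) (v l)) *
          Pi.single (M := fun _ => ℝ) i 1 k +
        2 * γ * v l * ((v l ^ 2 - v k ^ 2) / pairGap ε (v l) (v k)) *
          Pi.single (M := fun _ => ℝ) i 1 l) x := by
    intro k l
    refine (((hgap k l).log (pairGap_pos hε _ _).ne').mul_const (γ / 2)).congr_deriv ?_
    rw [pairGap_comm ε (v l) (v k), ← hv]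
    ring
  refine ((HasDerivAt.fun_sum fun k _ => HasDerivAt.fun_sum fun l _ => hlog k l).exp).congr_deriv ?_
  rw [← hv, mul_comm, ← mul_assoc]
  congr 1
  simp only [sum_add_distrib]
  rw [sum_comm' (s := univ) (t := fun k : ι => ({k}ᶜ : Finset ι)) (t' := univ)
    (s' := fun k : ι => ({k}ᶜ : Finset ι)) (by simp [eq_comm])
    (f := fun k l => 2 * γ * v l * ((v l ^ 2 - v k ^ 2) / pairGap ε (v l) (v k)) *
          Pi.single (M := fun _ => ℝ) i 1 l)]
  simp only [← sum_mul]
  simp only [Pi.single_apply, mul_ite, mul_one, mul_zero, sum_ite_eq', mem_univ, if_true]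
  rw [repulsionForce, ← hvi, ← mul_sum]
  ring

end Repulsion

section Density

open Filter Topology

variable {ι : Type*} [Fintype ι] [DecidableEq ι]

/-- The regularised Mehta density of the second type. -/
noncomputable def mehtaDensity (a γ ε : ℝ) (u : ι → ℝ) : ℝ :=
  repulsion γ ε u * ∏ i, radialWeight a (u i)

omit [DecidableEq ι] in
lemma prod_radialWeight_nonneg (a : ℝ) (u : ι → ℝ) : 0 ≤ ∏ i, radialWeight a (u i) :=
  prod_nonneg fun _ _ => radialWeight_nonneg _ _

lemma mehtaDensity_nonneg (a γ ε : ℝ) (u : ι → ℝ) : 0 ≤ mehtaDensity a γ ε u :=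
  mul_nonneg (repulsion_nonneg _ _ _) (prod_radialWeight_nonneg _ _)

omit [DecidableEq ι] in
lemma measurable_prod_radialWeight (a : ℝ) :
    Measurable fun u : ι → ℝ => ∏ i, radialWeight a (u i) :=
  Finset.measurable_fun_prod _ fun i _ => (measurable_radialWeight a).comp (measurable_pi_apply i)

lemma measurable_mehtaDensity (a : ℝ) {γ : ℝ} (hγ : 0 < γ) (ε : ℝ) :
    Measurable (mehtaDensity a γ ε : (ι → ℝ) → ℝ) :=
  (continuous_repulsion hγ ε).measurable.mul (measurable_prod_radialWeight a)

omit [DecidableEq ι] in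
lemma integrable_growth_pow_mul_prod_radialWeight {a : ℝ} (ha : 0 < a) (n : ℕ) :
    Integrable fun u : ι → ℝ => growth u ^ n * ∏ i, radialWeight a (u i) := by
  simp only [growth, ← prod_pow, ← prod_mul_distrib]
  exact Integrable.fintype_prod (f := fun _ x => (1 + x ^ 2) ^ n * radialWeight a x)
    fun _ => integrable_one_add_sq_pow_mul_radialWeight n ha

lemma exists_abs_mul_mehtaDensity_le (ι : Type*) [Fintype ι] [DecidableEq ι] (a : ℝ) {γ : ℝ}
    (hγ : 0 < γ) (m : ℕ) : ∃ n : ℕ, ∀ (C x ε : ℝ) (u : ι → ℝ), 0 ≤ ε → ε ≤ 1 →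
      |x| ≤ C * growth u ^ m →
      |x * mehtaDensity a γ ε u| ≤ C * (growth u ^ n * ∏ i, radialWeight a (u i)) := by
  obtain ⟨n, hn⟩ := exists_repulsion_le_growth_pow ι hγ
  refine ⟨m + n, fun C x ε u hε hε1 hx => ?_⟩
  rw [abs_mul, abs_of_nonneg (mehtaDensity_nonneg _ _ _ _), mehtaDensity, pow_add, ← mul_assoc,
    ← mul_assoc, ← mul_assoc]
  exact mul_le_mul_of_nonneg_right (mul_le_mul hx (hn ε hε hε1 u) (repulsion_nonneg _ _ _)
    ((abs_nonneg x).trans hx)) (prod_radialWeight_nonneg _ _)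

lemma integrable_mul_mehtaDensity {a γ ε C : ℝ} (ha : 0 < a) (hγ : 0 < γ) (hε : 0 ≤ ε)
    (hε1 : ε ≤ 1) {m : ℕ} {f : (ι → ℝ) → ℝ} (hf : Measurable f)
    (hb : ∀ u, |f u| ≤ C * growth u ^ m) : Integrable fun u => f u * mehtaDensity a γ ε u := by
  obtain ⟨n, hn⟩ := exists_abs_mul_mehtaDensity_le ι a hγ m
  exact ((integrable_growth_pow_mul_prod_radialWeight ha n).const_mul C).mono'
    (hf.mul (measurable_mehtaDensity a hγ ε)).aestronglyMeasurable
    (.of_forall fun u => hn C _ ε u hε hε1 (hb u))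

lemma tendsto_integral_mul_mehtaDensity {a γ C : ℝ} (ha : 0 < a) (hγ : 0 < γ) {m : ℕ}
    {f : ℝ → (ι → ℝ) → ℝ} {g : (ι → ℝ) → ℝ} (hf : ∀ ε, Measurable (f ε))
    (hb : ∀ ε u, |f ε u| ≤ C * growth u ^ m)
    (hlim : ∀ u, Tendsto (fun ε => f ε u * repulsion γ ε u) (𝓝[>] 0)
      (𝓝 (g u * repulsion γ 0 u))) :
    Tendsto (fun ε => ∫ u, f ε u * mehtaDensity a γ ε u) (𝓝[>] 0)
      (𝓝 (∫ u, g u * mehtaDensity a γ 0 u)) := by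
  obtain ⟨n, hn⟩ := exists_abs_mul_mehtaDensity_le ι a hγ m
  have hev : ∀ᶠ ε : ℝ in 𝓝[>] 0, 0 ≤ ε ∧ ε ≤ 1 := by
    filter_upwards [Ioc_mem_nhdsGT (zero_lt_one' ℝ)] with ε hε using ⟨hε.1.le, hε.2⟩
  refine tendsto_integral_filter_of_dominated_convergence
    (fun u => C * (growth u ^ n * ∏ i, radialWeight a (u i)))
    (.of_forall fun ε => ((hf ε).mul (measurable_mehtaDensity a hγ ε)).aestronglyMeasurable) ?_
    ((integrable_growth_pow_mul_prod_radialWeight ha n).const_mul C) (.of_forall fun u => ?_)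
  · filter_upwards [hev] with ε hε
    exact .of_forall fun u => hn C _ ε u hε.1 hε.2 (hb ε u)
  · simp only [mehtaDensity, ← mul_assoc]
    exact (hlim u).mul_const _

lemma mehtaDensity_comp_perm (a γ ε : ℝ) (u : ι → ℝ) (σ : Equiv.Perm ι) :
    mehtaDensity a γ ε (u ∘ σ) = mehtaDensity a γ ε u := by
  rw [mehtaDensity, mehtaDensity, repulsion_comp_perm,
    ← Equiv.prod_comp σ fun i => radialWeight a (u i)]
  rfl

omit [DecidableEq ι] in
lemma integral_comp_perm (f : (ι → ℝ) → ℝ) (σ : Equiv.Perm ι) :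
    ∫ u, f (u ∘ σ) = ∫ u, f u :=
  (volume_measurePreserving_piCongrLeft (fun _ : ι => ℝ) σ).symm.integral_comp' f

lemma integral_comp_perm_mul_mehtaDensity (a γ ε : ℝ) (f : (ι → ℝ) → ℝ) (σ : Equiv.Perm ι) :
    ∫ u, f (u ∘ σ) * mehtaDensity a γ ε u = ∫ u, f u * mehtaDensity a γ ε u := by
  rw [← integral_comp_perm (fun u => f u * mehtaDensity a γ ε u) σ]
  simp only [mehtaDensity_comp_perm]

lemma growth_update_le (u : ι → ℝ) (i : ι) (x : ℝ) :
    growth (Function.update u i x) ≤ growth u * (1 + x ^ 2) := by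
  rw [growth, growth, Fintype.prod_eq_mul_prod_compl i, Fintype.prod_eq_mul_prod_compl i,
    prod_congr rfl (g := fun j => 1 + u j ^ 2) fun j hj => by
      rw [Function.update_of_ne (by simpa using hj)], Function.update_self, mul_comm]
  have : 0 ≤ ∏ j ∈ {i}ᶜ, (1 + u j ^ 2) := prod_nonneg fun j _ => by positivity
  gcongr
  nlinarith [sq_nonneg (u i)]

lemma exists_repulsion_update_le {γ ε : ℝ} (hγ : 0 < γ) (hε : 0 < ε) (hε1 : ε ≤ 1) (u : ι → ℝ)
    (i : ι) : ∃ (C : ℝ) (n : ℕ), ∀ x,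
      |repulsion γ ε (Function.update u i x)| ≤ C * (1 + x ^ 2) ^ n ∧
      |repulsionForce γ ε i (Function.update u i x) * repulsion γ ε (Function.update u i x)| ≤
        C * (1 + x ^ 2) ^ n := by
  obtain ⟨n, hn⟩ := exists_repulsion_le_growth_pow ι hγ
  set K : ℝ := 4 * γ * (Fintype.card ι * (1 / ε))
  have hK : 0 ≤ K := by positivity
  have hG : 0 < growth u := zero_lt_one.trans_le (one_le_growth u)
  have hrep : ∀ x, repulsion γ ε (Function.update u i x) ≤ growth u ^ n * (1 + x ^ 2) ^ n :=
    fun x => (hn ε hε.le hε1 _).trans (by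
      rw [← mul_pow]
      exact pow_le_pow_left₀ (zero_le_one.trans (one_le_growth _)) (growth_update_le u i x) n)
  refine ⟨(1 + K) * growth u ^ n, n, fun x => ?_⟩
  have h0 := repulsion_nonneg γ ε (Function.update u i x)
  have h1 : 0 ≤ growth u ^ n * (1 + x ^ 2) ^ n := by positivity
  rw [abs_mul, abs_of_nonneg h0, mul_assoc]
  constructor
  · nlinarith [hrep x, mul_nonneg hK h1]
  · have := mul_le_mul (abs_repulsionForce_le hγ hε i (Function.update u i x)) (hrep x) h0 hK
    nlinarith

end Density

section Coordinate

variable {n : ℕ}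

lemma integral_fin_insertNth {f : (Fin (n + 1) → ℝ) → ℝ} (hf : Integrable f) (i : Fin (n + 1)) :
    ∫ u, f u = ∫ y : Fin n → ℝ, ∫ x : ℝ, f (i.insertNth x y) := by
  have e := (volume_preserving_piFinSuccAbove (fun _ : Fin (n + 1) => ℝ) i).symm
  rw [← e.integral_comp' f]
  exact integral_prod_symm _ ((e.integrable_comp_emb (MeasurableEquiv.measurableEmbedding _)).2 hf)

lemma prod_radialWeight_insertNth (a : ℝ) (i : Fin (n + 1)) (x : ℝ) (y : Fin n → ℝ) :
    ∏ j, radialWeight a (i.insertNth (α := fun _ => ℝ) x y j) =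
      radialWeight a x * ∏ j, radialWeight a (y j) := by
  simp [Fin.prod_univ_succAbove _ i]

lemma sq_update_abs {ι : Type*} [DecidableEq ι] (u : ι → ℝ) (i : ι) (x : ℝ) (k : ι) :
    Function.update u i |x| k ^ 2 = Function.update u i x k ^ 2 := by
  rcases eq_or_ne k i with rfl | hk <;> simp [*]

lemma measurable_repulsion_update_mul_force {γ : ℝ} (hγ : 0 < γ) (ε : ℝ) (u : Fin n → ℝ)
    (i : Fin n) : Measurable fun x => repulsionForce γ ε i (Function.update u i x) *
      repulsion γ ε (Function.update u i x) :=
  ((measurable_repulsionForce γ ε i).comp (measurable_update u)).mul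
    ((continuous_repulsion hγ ε).measurable.comp (measurable_update u))

lemma integral_mehtaDensity_stein {a γ ε C : ℝ} (ha : 0 < a) (hγ : 0 < γ) (hε : 0 < ε)
    (hε1 : ε ≤ 1) (i : Fin (n + 1)) {m : ℕ} {c : (Fin (n + 1) → ℝ) → ℝ} (hc : Measurable c)
    (hcb : ∀ u, |c u| ≤ C * growth u ^ m) (hci : ∀ u x, c (Function.update u i x) = c u) :
    ∫ u, c u * (2 * a + u i ^ 2 * repulsionForce γ ε i u - u i ^ 2) * mehtaDensity a γ ε u = 0 := by
  set K : ℝ := 4 * γ * (Fintype.card (Fin (n + 1)) * (1 / ε)) with hK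
  have hK0 : 0 ≤ K := by positivity
  have hbound : ∀ u : Fin (n + 1) → ℝ,
      |c u * (2 * a + u i ^ 2 * repulsionForce γ ε i u - u i ^ 2)| ≤
        C * (2 * a + K + 1) * growth u ^ (m + 1) := by
    intro u
    have hF : |repulsionForce γ ε i u| ≤ K := abs_repulsionForce_le hγ hε i u
    have hG : 1 + u i ^ 2 ≤ growth u := by
      refine (Finset.prod_singleton (fun j => 1 + u j ^ 2) i).symm.trans_le ?_
      exact Finset.prod_le_prod_of_subset_of_one_le (subset_univ _) (fun k _ => by positivity)
        fun k _ _ => by nlinarith [sq_nonneg (u k)]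
    rw [abs_mul, pow_succ (growth u), show C * (2 * a + K + 1) * (growth u ^ m * growth u) =
      (C * growth u ^ m) * ((2 * a + K + 1) * growth u) by ring]
    refine mul_le_mul (hcb u) ?_ (abs_nonneg _) ((abs_nonneg _).trans (hcb u))
    have h1 : |u i ^ 2 * repulsionForce γ ε i u| ≤ u i ^ 2 * K := by
      rw [abs_mul, abs_of_nonneg (sq_nonneg (u i))]; gcongr
    have h2 : 0 ≤ u i ^ 2 := sq_nonneg _
    have h3 := abs_le.1 h1
    have h4 : (2 * a + K + 1) * (1 + u i ^ 2) ≤ (2 * a + K + 1) * growth u := by gcongr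
    rw [abs_le]
    constructor <;> nlinarith
  have hmeas : Measurable fun u : Fin (n + 1) → ℝ =>
      c u * (2 * a + u i ^ 2 * repulsionForce γ ε i u - u i ^ 2) := by
    have := measurable_repulsionForce γ ε i
    fun_prop
  rw [integral_fin_insertNth (integrable_mul_mehtaDensity ha hγ hε.le hε1 hmeas hbound) i]
  refine integral_eq_zero_of_ae (.of_forall fun y => ?_)
  set u₀ : Fin (n + 1) → ℝ := i.insertNth 0 y
  have hu : ∀ x, i.insertNth x y = Function.update u₀ i x := fun x => (Fin.update_insertNth ..).symm
  obtain ⟨B, k, hB⟩ := exists_repulsion_update_le hγ hε hε1 u₀ i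
  have key := integral_radialWeight_stein ha (hasDerivAt_repulsion_update hε γ u₀ i)
    (measurable_repulsion_update_mul_force hγ ε u₀ i)
    (fun x => repulsion_congr_sq γ ε (sq_update_abs u₀ i x))
    (fun x => by
      rw [repulsion_congr_sq γ ε (sq_update_abs u₀ i x),
        repulsionForce_congr_sq γ ε i (sq_update_abs u₀ i x)])
    (fun x => (hB x).1) (fun x => (hB x).2)
  simp only [Pi.zero_apply, mehtaDensity, prod_radialWeight_insertNth]
  rw [← mul_zero (c u₀ * ∏ j, radialWeight a (y j)), ← key, ← integral_const_mul]
  congr 1 with x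
  rw [hu, hci, Function.update_self]
  ring

lemma integral_mehtaDensity_one_boundary {γ ε : ℝ} (hγ : 0 < γ) (hε : 0 < ε) (hε1 : ε ≤ 1)
    (i : Fin (n + 1)) :
    ∫ u, (repulsionForce γ ε i u - 1) * mehtaDensity 1 γ ε u =
      -2 * ∫ y : Fin n → ℝ, repulsion γ ε (i.insertNth (α := fun _ => ℝ) 0 y) *
        ∏ j, radialWeight 1 (y j) := by
  set K : ℝ := 4 * γ * (Fintype.card (Fin (n + 1)) * (1 / ε)) with hK
  have hbound : ∀ u : Fin (n + 1) → ℝ, |repulsionForce γ ε i u - 1| ≤ (K + 1) * growth u ^ 0 := by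
    intro u
    have hF : |repulsionForce γ ε i u| ≤ K := abs_repulsionForce_le hγ hε i u
    rw [pow_zero, mul_one]
    exact (abs_sub _ _).trans (by simpa using hF)
  rw [integral_fin_insertNth (integrable_mul_mehtaDensity one_pos hγ hε.le hε1
    ((measurable_repulsionForce γ ε i).sub_const 1) hbound) i, ← integral_const_mul]
  congr 1 with y
  set u₀ : Fin (n + 1) → ℝ := i.insertNth 0 y
  have hu : ∀ x, i.insertNth x y = Function.update u₀ i x := fun x => (Fin.update_insertNth ..).symm
  obtain ⟨B, k, hB⟩ := exists_repulsion_update_le hγ hε hε1 u₀ i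
  have key := integral_radialWeight_one_boundary (hasDerivAt_repulsion_update hε γ u₀ i)
    (measurable_repulsion_update_mul_force hγ ε u₀ i)
    (fun x => repulsion_congr_sq γ ε (sq_update_abs u₀ i x))
    (fun x => by
      rw [repulsion_congr_sq γ ε (sq_update_abs u₀ i x),
        repulsionForce_congr_sq γ ε i (sq_update_abs u₀ i x)])
    (fun x => (hB x).1) (fun x => (hB x).2)
  rw [← hu] at key
  simp only [mehtaDensity, prod_radialWeight_insertNth]
  rw [← mul_assoc, ← key, ← integral_mul_const]
  congr 1 with x
  rw [hu]
  ring

end Coordinate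

section Moments

open Filter Topology

variable {ι : Type*} [Fintype ι] [DecidableEq ι]

/-- The moment `∏_{j ∈ S} u_j²` of the regularised Mehta density. -/
noncomputable def mehtaMoment (a γ ε : ℝ) (S : Finset ι) : ℝ :=
  ∫ u : ι → ℝ, (∏ j ∈ S, u j ^ 2) * mehtaDensity a γ ε u

omit [DecidableEq ι] in
lemma prod_sq_le_growth (S : Finset ι) (u : ι → ℝ) : ∏ j ∈ S, u j ^ 2 ≤ growth u :=
  (prod_le_prod (fun _ _ => sq_nonneg _) fun j _ => by linarith).trans
    (Finset.prod_le_prod_of_subset_of_one_le (f := fun j => 1 + u j ^ 2) (subset_univ S)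
      (fun k _ => by positivity) fun k _ _ => by nlinarith [sq_nonneg (u k)])

omit [DecidableEq ι] in
lemma abs_prod_sq_le (S : Finset ι) (u : ι → ℝ) : |∏ j ∈ S, u j ^ 2| ≤ 1 * growth u ^ 1 := by
  rw [abs_of_nonneg (prod_nonneg fun _ _ => sq_nonneg _), one_mul, pow_one]
  exact prod_sq_le_growth S u

omit [Fintype ι] [DecidableEq ι] in
lemma measurable_sub_div_pairGap (ε : ℝ) (i j : ι) :
    Measurable fun u : ι → ℝ => (u i ^ 2 - u j ^ 2) / pairGap ε (u i) (u j) := by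
  unfold pairGap; fun_prop

omit [Fintype ι] in
lemma prod_sq_comp_swap {S : Finset ι} {i j : ι} (h : i ∈ S ↔ j ∈ S) (u : ι → ℝ) :
    ∏ k ∈ S, (u ∘ Equiv.swap i j) k ^ 2 = ∏ k ∈ S, u k ^ 2 := by
  refine prod_equiv (Equiv.swap i j) (fun k => ?_) fun _ _ => rfl
  rcases eq_or_ne k i with rfl | hi
  · rw [Equiv.swap_apply_left]; exact h
  · rcases eq_or_ne k j with rfl | hj
    · rw [Equiv.swap_apply_right]; exact h.symm
    · rw [Equiv.swap_apply_of_ne_of_ne hi hj]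

/-- Antisymmetry under exchanging `u i` and `u j`. -/
lemma integral_prod_sq_mul_sub_div_eq_zero (a γ ε : ℝ) {S : Finset ι} {i j : ι}
    (h : i ∈ S ↔ j ∈ S) :
    ∫ u : ι → ℝ, (∏ k ∈ S, u k ^ 2) * ((u i ^ 2 - u j ^ 2) / pairGap ε (u i) (u j)) *
      mehtaDensity a γ ε u = 0 := by
  have := integral_comp_perm_mul_mehtaDensity a γ ε (fun u : ι → ℝ => (∏ k ∈ S, u k ^ 2) *
    ((u i ^ 2 - u j ^ 2) / pairGap ε (u i) (u j))) (Equiv.swap i j)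
  simp only [prod_sq_comp_swap h] at this
  simp only [Function.comp_apply, Equiv.swap_apply_left, Equiv.swap_apply_right] at this
  have h2 : ∀ u : ι → ℝ, (∏ k ∈ S, u k ^ 2) * ((u j ^ 2 - u i ^ 2) / pairGap ε (u j) (u i)) *
      mehtaDensity a γ ε u = -((∏ k ∈ S, u k ^ 2) *
        ((u i ^ 2 - u j ^ 2) / pairGap ε (u i) (u j)) * mehtaDensity a γ ε u) := by
    intro u; rw [pairGap_comm ε (u j)]; ring
  simp only [h2, integral_neg] at this
  linarith

lemma integrable_prod_sq_mul_sub_div {a γ ε : ℝ} (ha : 0 < a) (hγ : 0 < γ) (hε : 0 < ε)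
    (hε1 : ε ≤ 1) (S : Finset ι) (i j : ι) :
    Integrable fun u : ι → ℝ => (∏ k ∈ S, u k ^ 2) *
      ((u i ^ 2 - u j ^ 2) / pairGap ε (u i) (u j)) * mehtaDensity a γ ε u := by
  refine integrable_mul_mehtaDensity (C := 1 / ε) (m := 1) ha hγ hε.le hε1
    (Measurable.mul (by fun_prop) (measurable_sub_div_pairGap ε i j)) fun u => ?_
  rw [abs_mul, mul_comm]
  exact mul_le_mul (abs_sub_div_pairGap_le hε _ _) (by simpa using abs_prod_sq_le S u)
    (abs_nonneg _) (by positivity)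

/-- Symmetrisation under exchanging `u i` and `u j`. -/
lemma integral_prod_insert_sq_mul_sub_div {a γ ε : ℝ} (ha : 0 < a) (hγ : 0 < γ) (hε : 0 < ε)
    (hε1 : ε ≤ 1) {S : Finset ι} {i j : ι} (hi : i ∉ S) (hj : j ∉ S) :
    ∫ u : ι → ℝ, (∏ k ∈ insert i S, u k ^ 2) * ((u i ^ 2 - u j ^ 2) / pairGap ε (u i) (u j)) *
      mehtaDensity a γ ε u = 1 / 2 * ∫ u : ι → ℝ, (∏ k ∈ S, u k ^ 2) *
        ((u i ^ 2 - u j ^ 2) ^ 2 / pairGap ε (u i) (u j)) * mehtaDensity a γ ε u := by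
  have hsym := integral_comp_perm_mul_mehtaDensity a γ ε (fun u : ι → ℝ =>
    (u i ^ 2 * ∏ k ∈ S, u k ^ 2) * ((u i ^ 2 - u j ^ 2) / pairGap ε (u i) (u j))) (Equiv.swap i j)
  simp only [prod_sq_comp_swap (iff_of_false hi hj)] at hsym
  simp only [Function.comp_apply, Equiv.swap_apply_left, Equiv.swap_apply_right,
    ← prod_insert (f := fun k => _ ^ 2) hi, ← prod_insert (f := fun k => _ ^ 2) hj] at hsym
  have h1 := integrable_prod_sq_mul_sub_div ha hγ hε hε1 (insert i S) i j
  have h2 := integrable_prod_sq_mul_sub_div ha hγ hε hε1 (insert j S) j i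
  have hadd : ∫ u : ι → ℝ, (∏ k ∈ S, u k ^ 2) *
        ((u i ^ 2 - u j ^ 2) ^ 2 / pairGap ε (u i) (u j)) * mehtaDensity a γ ε u =
      (∫ u : ι → ℝ, (∏ k ∈ insert i S, u k ^ 2) *
        ((u i ^ 2 - u j ^ 2) / pairGap ε (u i) (u j)) * mehtaDensity a γ ε u) +
      ∫ u : ι → ℝ, (∏ k ∈ insert j S, u k ^ 2) *
        ((u j ^ 2 - u i ^ 2) / pairGap ε (u j) (u i)) * mehtaDensity a γ ε u := by
    rw [← integral_add h1 h2]
    congr 1 with u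
    rw [prod_insert hi, prod_insert hj, pairGap_comm ε (u j)]
    ring
  rw [hadd, hsym]
  ring

lemma mehtaMoment_insert_of_pos {n : ℕ} {a γ ε : ℝ} (ha : 0 < a) (hγ : 0 < γ) (hε : 0 < ε)
    (hε1 : ε ≤ 1) {S : Finset (Fin (n + 1))} {i : Fin (n + 1)} (hi : i ∉ S) :
    mehtaMoment a γ ε (insert i S) = 2 * a * mehtaMoment a γ ε S +
      2 * γ * ∑ j ∈ (insert i S)ᶜ, ∫ u : Fin (n + 1) → ℝ, (∏ k ∈ S, u k ^ 2) *
        ((u i ^ 2 - u j ^ 2) ^ 2 / pairGap ε (u i) (u j)) * mehtaDensity a γ ε u := by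
  have hstein := integral_mehtaDensity_stein ha hγ hε hε1 i
    (c := fun u => ∏ k ∈ S, u k ^ 2) (by fun_prop) (abs_prod_sq_le S) fun u x =>
      prod_congr rfl fun k hk => by rw [Function.update_of_ne (ne_of_mem_of_not_mem hk hi)]
  have hint : ∀ T : Finset (Fin (n + 1)), Integrable fun u : Fin (n + 1) → ℝ =>
      (∏ k ∈ T, u k ^ 2) * mehtaDensity a γ ε u := fun T =>
    integrable_mul_mehtaDensity ha hγ hε.le hε1 (by fun_prop) (abs_prod_sq_le T)
  have hT := fun j => integrable_prod_sq_mul_sub_div ha hγ hε hε1 (insert i S) i j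
  have hexp : ∀ u : Fin (n + 1) → ℝ, (∏ k ∈ S, u k ^ 2) *
      (2 * a + u i ^ 2 * repulsionForce γ ε i u - u i ^ 2) * mehtaDensity a γ ε u =
      2 * a * ((∏ k ∈ S, u k ^ 2) * mehtaDensity a γ ε u) +
      4 * γ * (∑ j ∈ {i}ᶜ, (∏ k ∈ insert i S, u k ^ 2) *
        ((u i ^ 2 - u j ^ 2) / pairGap ε (u i) (u j)) * mehtaDensity a γ ε u) -
      (∏ k ∈ insert i S, u k ^ 2) * mehtaDensity a γ ε u := by
    intro u
    rw [← sum_mul, ← mul_sum, prod_insert hi, repulsionForce]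
    ring
  have hA : Integrable fun u : Fin (n + 1) → ℝ =>
      2 * a * ((∏ k ∈ S, u k ^ 2) * mehtaDensity a γ ε u) := (hint S).const_mul _
  have hB : Integrable fun u : Fin (n + 1) → ℝ => 4 * γ * ∑ j ∈ {i}ᶜ,
      (∏ k ∈ insert i S, u k ^ 2) * ((u i ^ 2 - u j ^ 2) / pairGap ε (u i) (u j)) *
        mehtaDensity a γ ε u := (integrable_finsetSum _ fun j _ => hT j).const_mul _
  have hAB : Integrable fun u : Fin (n + 1) → ℝ =>
      2 * a * ((∏ k ∈ S, u k ^ 2) * mehtaDensity a γ ε u) + 4 * γ * ∑ j ∈ {i}ᶜ,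
      (∏ k ∈ insert i S, u k ^ 2) * ((u i ^ 2 - u j ^ 2) / pairGap ε (u i) (u j)) *
        mehtaDensity a γ ε u := hA.add hB
  simp only [hexp] at hstein
  rw [integral_sub hAB (hint _), integral_add hA hB, integral_const_mul, integral_const_mul,
    integral_finsetSum _ fun j _ => hT j] at hstein
  have hsum : ∑ j ∈ {i}ᶜ, ∫ u : Fin (n + 1) → ℝ, (∏ k ∈ insert i S, u k ^ 2) *
        ((u i ^ 2 - u j ^ 2) / pairGap ε (u i) (u j)) * mehtaDensity a γ ε u =
      ∑ j ∈ (insert i S)ᶜ, 1 / 2 * ∫ u : Fin (n + 1) → ℝ, (∏ k ∈ S, u k ^ 2) *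
        ((u i ^ 2 - u j ^ 2) ^ 2 / pairGap ε (u i) (u j)) * mehtaDensity a γ ε u := by
    symm
    refine sum_subset_zero_on_sdiff (compl_subset_compl.2 (by simp)) (fun j hj => ?_) fun j hj => ?_
    · have : j ∈ insert i S := not_not.1 (mt mem_compl.2 (mem_sdiff.1 hj).2)
      exact integral_prod_sq_mul_sub_div_eq_zero a γ ε (by simp [this])
    · have : j ∉ S := fun h => (mem_compl.1 hj) (mem_insert_of_mem h)
      exact (integral_prod_insert_sq_mul_sub_div ha hγ hε hε1 hi this).symm
  rw [hsum, ← mul_sum] at hstein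
  simp only [mehtaMoment]
  linarith

lemma tendsto_mehtaMoment {a γ : ℝ} (ha : 0 < a) (hγ : 0 < γ) (S : Finset ι) :
    Tendsto (fun ε => mehtaMoment a γ ε S) (𝓝[>] 0) (𝓝 (mehtaMoment a γ 0 S)) :=
  tendsto_integral_mul_mehtaDensity ha hγ (f := fun _ u => ∏ k ∈ S, u k ^ 2)
    (g := fun u => ∏ k ∈ S, u k ^ 2) (fun _ => by fun_prop) (fun _ => abs_prod_sq_le S) fun u =>
      (((continuous_repulsion_left hγ u).tendsto 0).mono_left nhdsWithin_le_nhds).const_mul _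

lemma repulsion_zero_of_sq_eq {γ : ℝ} (hγ : 0 < γ) {u : ι → ℝ} {i j : ι} (hij : i ≠ j)
    (h : u i ^ 2 = u j ^ 2) : repulsion γ 0 u = 0 :=
  prod_eq_zero (mem_univ i) (prod_eq_zero (i := j) (by simpa using hij.symm) (by
    rw [pairGap, h, sub_self, zero_pow two_ne_zero, add_zero, Real.zero_rpow (by positivity)]))

lemma tendsto_integral_sq_div_pairGap {a γ : ℝ} (ha : 0 < a) (hγ : 0 < γ) (S : Finset ι) {i j : ι}
    (hij : i ≠ j) :
    Tendsto (fun ε => ∫ u : ι → ℝ, (∏ k ∈ S, u k ^ 2) *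
        ((u i ^ 2 - u j ^ 2) ^ 2 / pairGap ε (u i) (u j)) * mehtaDensity a γ ε u)
      (𝓝[>] 0) (𝓝 (mehtaMoment a γ 0 S)) := by
  refine tendsto_integral_mul_mehtaDensity ha hγ (C := 1) (m := 1) (g := fun u => ∏ k ∈ S, u k ^ 2)
    (f := fun ε u => (∏ k ∈ S, u k ^ 2) * ((u i ^ 2 - u j ^ 2) ^ 2 / pairGap ε (u i) (u j)))
    (fun ε => by unfold pairGap; fun_prop) (fun ε u => ?_) fun u => ?_
  · rw [abs_mul, abs_of_nonneg (div_nonneg (sq_nonneg _) (pairGap_nonneg ε (u i) (u j)))]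
    exact (mul_le_of_le_one_right (abs_nonneg _) (sq_div_pairGap_le_one _ _ _)).trans
      (abs_prod_sq_le S u)
  · rcases eq_or_ne (u i ^ 2) (u j ^ 2) with h | h
    · simp [repulsion_zero_of_sq_eq hγ hij h, h]
    · have hd : (u i ^ 2 - u j ^ 2) ^ 2 ≠ 0 := pow_ne_zero 2 (sub_ne_zero.2 h)
      have hgap : Continuous fun ε => pairGap ε (u i) (u j) := by unfold pairGap; fun_prop
      have hlim : Tendsto (fun ε => (u i ^ 2 - u j ^ 2) ^ 2 / pairGap ε (u i) (u j)) (𝓝 0)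
          (𝓝 1) := by
        have h0 : pairGap 0 (u i) (u j) = (u i ^ 2 - u j ^ 2) ^ 2 := by simp [pairGap]
        have := Tendsto.div (tendsto_const_nhds (x := (u i ^ 2 - u j ^ 2) ^ 2)) (hgap.tendsto 0)
          (by rwa [h0])
        rwa [h0, div_self hd] at this
      simpa using ((hlim.const_mul (∏ k ∈ S, u k ^ 2)).mul
        ((continuous_repulsion_left hγ u).tendsto 0)).mono_left nhdsWithin_le_nhds

/-- Aomoto's recursion for the moments of the Mehta density. -/
lemma mehtaMoment_insert {n : ℕ} {a γ : ℝ} (ha : 0 < a) (hγ : 0 < γ)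
    {S : Finset (Fin (n + 1))} {i : Fin (n + 1)} (hi : i ∉ S) :
    mehtaMoment a γ 0 (insert i S) =
      2 * (a + γ * ((n : ℝ) - #S)) * mehtaMoment a γ 0 S := by
  have hlim : Tendsto (fun ε => mehtaMoment a γ ε (insert i S)) (𝓝[>] 0)
      (𝓝 (2 * a * mehtaMoment a γ 0 S +
        2 * γ * ∑ j ∈ (insert i S)ᶜ, mehtaMoment a γ 0 S)) := by
    refine Tendsto.congr' (f₁ := fun ε => 2 * a * mehtaMoment a γ ε S +
      2 * γ * ∑ j ∈ (insert i S)ᶜ, ∫ u : Fin (n + 1) → ℝ, (∏ k ∈ S, u k ^ 2) *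
        ((u i ^ 2 - u j ^ 2) ^ 2 / pairGap ε (u i) (u j)) * mehtaDensity a γ ε u) ?_ ?_
    · filter_upwards [Ioc_mem_nhdsGT (zero_lt_one' ℝ)] with ε hε
      exact (mehtaMoment_insert_of_pos ha hγ hε.1 hε.2 hi).symm
    · refine ((tendsto_mehtaMoment ha hγ S).const_mul _).add
        ((tendsto_finsetSum _ fun j hj => ?_).const_mul _)
      exact tendsto_integral_sq_div_pairGap ha hγ S (by rintro rfl; simp at hj)
  have hcard : (#((insert i S)ᶜ) : ℝ) = n - #S := by
    have h := card_add_card_compl (insert i S)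
    rw [card_insert_of_notMem hi, Fintype.card_fin] at h
    rw [eq_sub_iff_add_eq, add_comm]
    exact_mod_cast (by omega : #S + #((insert i S)ᶜ) = n)
  rw [tendsto_nhds_unique (tendsto_mehtaMoment ha hγ _) hlim, sum_const, nsmul_eq_mul, hcard]
  ring

lemma repulsion_zero_eq {N : ℕ} (γ : ℝ) (u : Fin N → ℝ) :
    repulsion γ 0 u = ∏ i, ∏ j ∈ Ioi i, |u j ^ 2 - u i ^ 2| ^ (2 * γ) := by
  rw [repulsion, ← prod_prod_Ioi_mul_eq_prod_prod_off_diag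
    fun j i => pairGap 0 (u i) (u j) ^ (γ / 2)]
  refine prod_congr rfl fun i _ => prod_congr rfl fun j _ => ?_
  rw [pairGap_comm 0 (u i), ← Real.mul_rpow (pairGap_nonneg _ _ _) (pairGap_nonneg _ _ _), pairGap,
    zero_pow two_ne_zero, add_zero, ← sq_abs (u j ^ 2 - u i ^ 2), ← pow_add, ← Real.rpow_natCast,
    ← Real.rpow_mul (abs_nonneg _)]
  congr 1
  push_cast
  ring

lemma repulsion_zero_insertNth {n : ℕ} (γ : ℝ) (y : Fin n → ℝ) :
    repulsion γ 0 ((0 : Fin (n + 1)).insertNth (α := fun _ => ℝ) 0 y) =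
      (∏ j, |y j| ^ (2 * (2 * γ))) * repulsion γ 0 y := by
  rw [repulsion_zero_eq, repulsion_zero_eq, Fin.prod_univ_succ]
  simp only [Fin.prod_Ioi_zero, Fin.prod_Ioi_succ, Fin.insertNth_zero', Fin.cons_succ,
    Fin.cons_zero]
  congr 1
  refine prod_congr rfl fun j _ => ?_
  rw [zero_pow two_ne_zero, sub_zero, abs_pow, ← Real.rpow_natCast, ← Real.rpow_mul (abs_nonneg _)]
  congr 1

lemma integral_mehtaDensity_one_of_pos {n : ℕ} {γ ε : ℝ} (hγ : 0 < γ) (hε : 0 < ε) (hε1 : ε ≤ 1) :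
    mehtaMoment 1 γ ε (∅ : Finset (Fin (n + 1))) =
      2 * ∫ y : Fin n → ℝ, repulsion γ ε ((0 : Fin (n + 1)).insertNth (α := fun _ => ℝ) 0 y) *
        ∏ j, radialWeight 1 (y j) := by
  have hb := integral_mehtaDensity_one_boundary hγ hε hε1 (0 : Fin (n + 1))
  have hexp : ∀ u : Fin (n + 1) → ℝ, (repulsionForce γ ε 0 u - 1) * mehtaDensity 1 γ ε u =
      4 * γ * (∑ j ∈ {0}ᶜ, (∏ k ∈ (∅ : Finset (Fin (n + 1))), u k ^ 2) *
        ((u 0 ^ 2 - u j ^ 2) / pairGap ε (u 0) (u j)) * mehtaDensity 1 γ ε u) -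
      (∏ k ∈ (∅ : Finset (Fin (n + 1))), u k ^ 2) * mehtaDensity 1 γ ε u := by
    intro u
    rw [← sum_mul, ← mul_sum, prod_empty, repulsionForce]
    ring
  have hT := fun j => integrable_prod_sq_mul_sub_div one_pos hγ hε hε1
    (∅ : Finset (Fin (n + 1))) 0 j
  simp only [hexp] at hb
  rw [integral_sub ((integrable_finsetSum _ fun j _ => hT j).const_mul _)
    (integrable_mul_mehtaDensity one_pos hγ hε.le hε1 (by fun_prop) (abs_prod_sq_le _)),
    integral_const_mul, integral_finsetSum _ fun j _ => hT j,
    sum_eq_zero fun j _ => integral_prod_sq_mul_sub_div_eq_zero 1 γ ε (by simp)] at hb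
  rw [mehtaMoment]
  linarith

omit [DecidableEq ι] in
lemma ae_forall_ne_zero : ∀ᵐ u : ι → ℝ, ∀ j, u j ≠ 0 :=
  ae_all_iff.2 fun j =>
    (Measure.quasiMeasurePreserving_eval (fun _ : ι => (volume : Measure ℝ)) j).ae
      (Measure.ae_ne volume 0)

omit [DecidableEq ι] in
lemma prod_abs_rpow_mul_prod_radialWeight {a b : ℝ} {u : ι → ℝ} (hu : ∀ j, u j ≠ 0) :
    (∏ j, |u j| ^ (2 * b)) * ∏ j, radialWeight a (u j) = ∏ j, radialWeight (a + b) (u j) := by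
  rw [← prod_mul_distrib]
  exact prod_congr rfl fun j _ => abs_rpow_mul_radialWeight (hu j)

/-- The value at `a = 1` reduces to a Mehta integral in one dimension less. -/
lemma mehtaMoment_one_empty {n : ℕ} {γ : ℝ} (hγ : 0 < γ) :
    mehtaMoment 1 γ 0 (∅ : Finset (Fin (n + 1))) =
      2 * mehtaMoment (1 + 2 * γ) γ 0 (∅ : Finset (Fin n)) := by
  obtain ⟨m, hm⟩ := exists_repulsion_le_growth_pow (Fin (n + 1)) hγ
  have hg : ∀ y : Fin n → ℝ, growth ((0 : Fin (n + 1)).insertNth (α := fun _ => ℝ) 0 y) =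
      growth y := fun y => by simp [growth, Fin.prod_univ_succ]
  have hlim : Tendsto (fun ε => ∫ y : Fin n → ℝ,
      repulsion γ ε ((0 : Fin (n + 1)).insertNth (α := fun _ => ℝ) 0 y) *
        ∏ j, radialWeight 1 (y j)) (𝓝[>] 0)
      (𝓝 (∫ y : Fin n → ℝ,
        repulsion γ 0 ((0 : Fin (n + 1)).insertNth (α := fun _ => ℝ) 0 y) *
        ∏ j, radialWeight 1 (y j))) := by
    refine tendsto_integral_filter_of_dominated_convergence
      (fun y => growth y ^ m * ∏ i, radialWeight 1 (y i)) (.of_forall fun ε => ?_) ?_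
      (integrable_growth_pow_mul_prod_radialWeight one_pos m) (.of_forall fun y => ?_)
    · refine (Measurable.mul ?_ (measurable_prod_radialWeight 1)).aestronglyMeasurable
      exact ((continuous_repulsion hγ ε).comp
        (by fun_prop : Continuous fun y : Fin n → ℝ =>
          (0 : Fin (n + 1)).insertNth (α := fun _ => ℝ) 0 y)).measurable
    · filter_upwards [Ioc_mem_nhdsGT (zero_lt_one' ℝ)] with ε hε
      refine .of_forall fun y => ?_
      rw [Real.norm_eq_abs, abs_of_nonneg (mul_nonneg (repulsion_nonneg _ _ _)
        (prod_radialWeight_nonneg _ _)), ← hg]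
      exact mul_le_mul_of_nonneg_right (hm ε hε.1.le hε.2 _) (prod_radialWeight_nonneg _ _)
    · exact (((continuous_repulsion_left hγ _).tendsto 0).mono_left nhdsWithin_le_nhds).mul_const _
  have hlim' : Tendsto (fun ε => mehtaMoment 1 γ ε (∅ : Finset (Fin (n + 1)))) (𝓝[>] 0) _ :=
    (hlim.const_mul 2).congr' (by
      filter_upwards [Ioc_mem_nhdsGT (zero_lt_one' ℝ)] with ε hε
      exact (integral_mehtaDensity_one_of_pos hγ hε.1 hε.2).symm)
  rw [tendsto_nhds_unique (tendsto_mehtaMoment one_pos hγ _) hlim', mehtaMoment]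
  congr 1
  refine integral_congr_ae ?_
  filter_upwards [ae_forall_ne_zero (ι := Fin n)] with y hy
  rw [repulsion_zero_insertNth, mehtaDensity, ← prod_abs_rpow_mul_prod_radialWeight hy,
    prod_empty]
  ring

end Moments

section Uniqueness

open Filter Topology

/-- Nonnegative solutions on `(0, ∞)` of `f (x + 1) = R x * f x` with `f (x + s) ≤ R x ^ s * f x`
for `s ∈ [0, 1]`. -/
structure IsShiftSolution (R f : ℝ → ℝ) : Prop where
  nonneg : ∀ x, 0 < x → 0 ≤ f x
  add_one : ∀ x, 0 < x → f (x + 1) = R x * f x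
  add_le : ∀ x, 0 < x → ∀ s ∈ Set.Icc (0 : ℝ) 1, f (x + s) ≤ R x ^ s * f x

variable {R f g : ℝ → ℝ}

lemma IsShiftSolution.div_add_one (hR : ∀ x, 0 < x → 0 < R x) (hf : IsShiftSolution R f)
    (hg : IsShiftSolution R g) {x : ℝ} (hx : 0 < x) : f (x + 1) / g (x + 1) = f x / g x := by
  rw [hf.add_one x hx, hg.add_one x hx, mul_div_mul_left _ _ (hR x hx).ne']

lemma IsShiftSolution.div_add_natCast (hR : ∀ x, 0 < x → 0 < R x) (hf : IsShiftSolution R f)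
    (hg : IsShiftSolution R g) {x : ℝ} (hx : 0 < x) (n : ℕ) :
    f (x + n) / g (x + n) = f x / g x := by
  induction n with
  | zero => simp
  | succ n ih =>
    rw [← ih, ← hf.div_add_one hR hg (by positivity : 0 < x + n), Nat.cast_succ, add_assoc]

lemma IsShiftSolution.div_add_le_mul (hR : ∀ x, 0 < x → 0 < R x) (hf : IsShiftSolution R f)
    (hg : IsShiftSolution R g) (hg0 : ∀ x, 0 < x → 0 < g x) {x s : ℝ} (hx : 0 < x)
    (hs : s ∈ Set.Icc (0 : ℝ) 1) :
    f (x + s) / g (x + s) ≤ f x / g x * (R (x + s) / R x) ^ (1 - s) := by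
  have hxs : 0 < x + s := by linarith [hs.1]
  have h1 := hf.add_le x hx s hs
  have h2 := hg.add_le (x + s) hxs (1 - s) ⟨by linarith [hs.2], by linarith [hs.1]⟩
  rw [show x + s + (1 - s) = x + 1 by ring, hg.add_one x hx] at h2
  have hRx := hR x hx
  have hRs := Real.rpow_pos_of_pos (hR _ hxs) (1 - s)
  have hsplit : R x ^ s * R x ^ (1 - s) = R x := by
    rw [← Real.rpow_add hRx, add_sub_cancel, Real.rpow_one]
  have hR1 := Real.rpow_pos_of_pos hRx (1 - s)
  have hRs' := Real.rpow_pos_of_pos hRx s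
  have hf0 := hf.nonneg x hx
  rw [Real.div_rpow (hR _ hxs).le hRx.le, div_mul_div_comm,
    div_le_div_iff₀ (hg0 _ hxs) (mul_pos (hg0 x hx) hR1)]
  calc f (x + s) * (g x * R x ^ (1 - s)) ≤ R x ^ s * f x * (g x * R x ^ (1 - s)) :=
        mul_le_mul_of_nonneg_right h1 (mul_pos (hg0 x hx) hR1).le
    _ = f x * (R x ^ s * R x ^ (1 - s) * g x) := by ring
    _ = f x * (R x * g x) := by rw [hsplit]
    _ ≤ f x * (R (x + s) ^ (1 - s) * g (x + s)) := mul_le_mul_of_nonneg_left h2 hf0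
    _ = f x * R (x + s) ^ (1 - s) * g (x + s) := by ring

lemma IsShiftSolution.div_add_le (hR : ∀ x, 0 < x → 0 < R x)
    (hlim : ∀ x s : ℝ, Tendsto (fun n : ℕ => R (x + n + s) / R (x + n)) atTop (𝓝 1))
    (hf : IsShiftSolution R f) (hg : IsShiftSolution R g) (hg0 : ∀ x, 0 < x → 0 < g x) {x s : ℝ}
    (hx : 0 < x) (hs : s ∈ Set.Icc (0 : ℝ) 1) : f (x + s) / g (x + s) ≤ f x / g x := by
  have h : Tendsto (fun n : ℕ => f x / g x * (R (x + n + s) / R (x + n)) ^ (1 - s)) atTop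
      (𝓝 (f x / g x * 1 ^ (1 - s))) :=
    ((hlim x s).rpow_const (Or.inl one_ne_zero)).const_mul _
  rw [Real.one_rpow, mul_one] at h
  refine ge_of_tendsto' h fun n => ?_
  have := hf.div_add_le_mul hR hg hg0 (by positivity : 0 < x + n) hs
  rwa [hf.div_add_natCast hR hg hx, add_right_comm,
    hf.div_add_natCast hR hg (by linarith [hs.1] : 0 < x + s), add_right_comm] at this

lemma IsShiftSolution.div_add_eq (hR : ∀ x, 0 < x → 0 < R x)
    (hlim : ∀ x s : ℝ, Tendsto (fun n : ℕ => R (x + n + s) / R (x + n)) atTop (𝓝 1))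
    (hf : IsShiftSolution R f) (hg : IsShiftSolution R g) (hg0 : ∀ x, 0 < x → 0 < g x) {x t : ℝ}
    (hx : 0 < x) (ht : 0 ≤ t) : f (x + t) / g (x + t) = f x / g x := by
  have hs : Int.fract t ∈ Set.Icc (0 : ℝ) 1 := ⟨Int.fract_nonneg t, (Int.fract_lt_one t).le⟩
  have hxs : 0 < x + Int.fract t := by linarith [hs.1]
  have ht' : x + t = x + Int.fract t + (⌊t⌋₊ : ℕ) := by
    rw [natCast_floor_eq_intCast_floor ht, add_assoc, Int.fract_add_floor]
  rw [ht', hf.div_add_natCast hR hg hxs]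
  refine le_antisymm (hf.div_add_le hR hlim hg hg0 hx hs) ?_
  have := hf.div_add_le hR hlim hg hg0 hxs (s := 1 - Int.fract t)
    ⟨by linarith [hs.2], by linarith [hs.1]⟩
  rwa [show x + Int.fract t + (1 - Int.fract t) = x + 1 by ring, hf.div_add_one hR hg hx] at this

/-- A shift equation has a unique such solution up to a constant, in the spirit of the
Bohr–Mollerup theorem. -/
lemma IsShiftSolution.div_eq_div (hR : ∀ x, 0 < x → 0 < R x)
    (hlim : ∀ x s : ℝ, Tendsto (fun n : ℕ => R (x + n + s) / R (x + n)) atTop (𝓝 1))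
    (hf : IsShiftSolution R f) (hg : IsShiftSolution R g) (hg0 : ∀ x, 0 < x → 0 < g x) {x y : ℝ}
    (hx : 0 < x) (hy : 0 < y) : f x / g x = f y / g y := by
  rw [← hf.div_add_eq hR hlim hg hg0 hx hy.le, add_comm, hf.div_add_eq hR hlim hg hg0 hy hx.le]

end Uniqueness

section ShiftFactor

open Filter Topology

/-- The factor by which Mehta's integral of the second type changes under `a ↦ a + 1`. -/
noncomputable def mehtaShift (N : ℕ) (γ a : ℝ) : ℝ := ∏ k ∈ range N, 2 * (a + γ * k)

lemma mehtaShift_pos (N : ℕ) {γ a : ℝ} (hγ : 0 < γ) (ha : 0 < a) : 0 < mehtaShift N γ a :=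
  prod_pos fun _ _ => by positivity

lemma tendsto_mehtaShift_div (N : ℕ) (γ x s : ℝ) :
    Tendsto (fun n : ℕ => mehtaShift N γ (x + n + s) / mehtaShift N γ (x + n)) atTop (𝓝 1) := by
  simp only [mehtaShift, ← prod_div_distrib]
  rw [← prod_const_one (s := range N)]
  refine tendsto_finsetProd _ fun k _ => ?_
  have hn : Tendsto (fun n : ℕ => (n : ℝ) + (x + γ * k)) atTop atTop :=
    tendsto_atTop_add_const_right _ _ tendsto_natCast_atTop_atTop
  have h : Tendsto (fun n : ℕ => 1 + s / ((n : ℝ) + (x + γ * k))) atTop (𝓝 (1 + 0)) :=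
    (hn.const_div_atTop s).const_add 1
  rw [add_zero] at h
  refine h.congr' ?_
  filter_upwards [hn.eventually_gt_atTop 0] with n hn
  have : x + n + γ * k ≠ 0 := by linarith
  rw [show (n : ℝ) + (x + γ * k) = x + n + γ * k by ring]
  field_simp
  ring

lemma mehtaMoment_univ {ι : Type*} [Fintype ι] [DecidableEq ι] {a : ℝ} (ha : 0 < a) (γ ε : ℝ) :
    mehtaMoment a γ ε (univ : Finset ι) = mehtaMoment (a + 1) γ ε (∅ : Finset ι) := by
  simp only [mehtaMoment, mehtaDensity, prod_empty, one_mul, ← sq_mul_radialWeight ha,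
    prod_mul_distrib]
  congr 1 with u
  ring

lemma mehtaMoment_eq_prod_mul {n : ℕ} {a γ : ℝ} (ha : 0 < a) (hγ : 0 < γ)
    (S : Finset (Fin (n + 1))) : mehtaMoment a γ 0 S =
      (∏ k ∈ range #S, 2 * (a + γ * ((n : ℝ) - k))) *
        mehtaMoment a γ 0 (∅ : Finset (Fin (n + 1))) := by
  induction S using Finset.induction_on with
  | empty => simp
  | insert i S hi ih =>
    rw [mehtaMoment_insert ha hγ hi, ih, card_insert_of_notMem hi, prod_range_succ]
    ring

lemma mehtaMoment_empty_add_one (N : ℕ) {a γ : ℝ} (ha : 0 < a) (hγ : 0 < γ) :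
    mehtaMoment (a + 1) γ 0 (∅ : Finset (Fin N)) =
      mehtaShift N γ a * mehtaMoment a γ 0 (∅ : Finset (Fin N)) := by
  rw [← mehtaMoment_univ ha]
  cases N with
  | zero => simp [mehtaShift, univ_eq_empty]
  | succ n =>
    rw [mehtaMoment_eq_prod_mul ha hγ, card_univ, Fintype.card_fin, mehtaShift,
      ← prod_range_reflect]
    congr 1
    refine prod_congr rfl fun k hk => ?_
    have hk : k ≤ n := Nat.lt_succ_iff.1 (mem_range.1 hk)
    rw [Nat.add_sub_cancel, Nat.cast_sub hk, sub_sub_cancel]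

lemma mehtaMoment_empty_add_le (N : ℕ) {a γ s : ℝ} (ha : 0 < a) (hγ : 0 < γ)
    (hs : s ∈ Set.Icc (0 : ℝ) 1) :
    mehtaMoment (a + s) γ 0 (∅ : Finset (Fin N)) ≤
      mehtaShift N γ a ^ s * mehtaMoment a γ 0 (∅ : Finset (Fin N)) := by
  have hr := mehtaShift_pos N hγ ha
  set r := mehtaShift N γ a with hr_def
  have hint : ∀ {b : ℝ}, 0 < b → ∀ T : Finset (Fin N), Integrable fun u : Fin N → ℝ =>
      (∏ k ∈ T, u k ^ 2) * mehtaDensity b γ 0 u := fun hb T =>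
    integrable_mul_mehtaDensity hb hγ le_rfl zero_le_one (by fun_prop) (abs_prod_sq_le T)
  have hA := (hint ha ∅).const_mul (r ^ s * (1 - s))
  have hB := (hint ha univ).const_mul (r ^ s * s / r)
  have hbound : ∀ y : ℝ, 0 ≤ y → y ^ s ≤ r ^ s * (1 - s) + r ^ s * s / r * y := fun y hy => by
    have h := rpow_one_add_le_one_add_mul_self
      (by linarith [div_nonneg hy hr.le] : -1 ≤ y / r - 1) hs.1 hs.2
    rw [add_sub_cancel, Real.div_rpow hy hr.le,
      div_le_iff₀ (Real.rpow_pos_of_pos hr s)] at h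
    refine h.trans (le_of_eq ?_)
    ring
  have hle : mehtaMoment (a + s) γ 0 (∅ : Finset (Fin N)) ≤
      ∫ u : Fin N → ℝ, (r ^ s * (1 - s) * ((∏ k ∈ ∅, u k ^ 2) * mehtaDensity a γ 0 u) +
        r ^ s * s / r * ((∏ k, u k ^ 2) * mehtaDensity a γ 0 u)) := by
    refine integral_mono_ae (hint (by linarith [hs.1]) ∅) (hA.add hB) ?_
    filter_upwards [ae_forall_ne_zero (ι := Fin N)] with u hu
    have hpow : ∏ j, |u j| ^ (2 * s) = (∏ j, u j ^ 2) ^ s := by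
      rw [← Real.finsetProd_rpow _ _ fun j _ => sq_nonneg (u j)]
      exact prod_congr rfl fun j _ => by
        rw [Real.rpow_mul (abs_nonneg _), Real.rpow_two, sq_abs]
    have h := mul_le_mul_of_nonneg_right (hbound (∏ j, u j ^ 2)
      (prod_nonneg fun _ _ => sq_nonneg _)) (mehtaDensity_nonneg a γ 0 u)
    calc (∏ k ∈ ∅, u k ^ 2) * mehtaDensity (a + s) γ 0 u
        = (∏ j, u j ^ 2) ^ s * mehtaDensity a γ 0 u := by
          rw [mehtaDensity, mehtaDensity, ← prod_abs_rpow_mul_prod_radialWeight hu, hpow,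
            prod_empty]
          ring
      _ ≤ _ := h
      _ = _ := by rw [prod_empty]; ring
  rw [integral_add hA hB, integral_const_mul, integral_const_mul] at hle
  have huniv : ∫ u : Fin N → ℝ, (∏ k, u k ^ 2) * mehtaDensity a γ 0 u =
      r * mehtaMoment a γ 0 (∅ : Finset (Fin N)) := by
    rw [hr_def, ← mehtaMoment_empty_add_one N ha hγ, ← mehtaMoment_univ ha, mehtaMoment]
  rw [huniv] at hle
  refine hle.trans (le_of_eq ?_)
  rw [mehtaMoment]
  field_simp
  ring

lemma isShiftSolution_mehtaMoment (N : ℕ) {γ : ℝ} (hγ : 0 < γ) :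
    IsShiftSolution (mehtaShift N γ) fun a => mehtaMoment a γ 0 (∅ : Finset (Fin N)) where
  nonneg a _ := integral_nonneg fun u => mul_nonneg (prod_nonneg fun _ _ => sq_nonneg _)
    (mehtaDensity_nonneg a γ 0 u)
  add_one _ ha := mehtaMoment_empty_add_one N ha hγ
  add_le _ ha _ hs := mehtaMoment_empty_add_le N ha hγ hs

end ShiftFactor

section ClosedForm

/-- The closed form of Mehta's integral of the second type. -/
noncomputable def mehtaClosedForm (N : ℕ) (γ a : ℝ) : ℝ :=
  (2 : ℝ) ^ (γ * N * (N - 1)) * ∏ k ∈ range N, (2 : ℝ) ^ a *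
    (Real.Gamma (1 + (k + 1) * γ) * Real.Gamma (a + γ * k) / Real.Gamma (1 + γ))

lemma mehtaClosedForm_pos (N : ℕ) {γ a : ℝ} (hγ : 0 < γ) (ha : 0 < a) :
    0 < mehtaClosedForm N γ a := by
  refine mul_pos (by positivity) (prod_pos fun k _ => mul_pos (by positivity)
    (div_pos (mul_pos ?_ ?_) ?_))
  all_goals exact Real.Gamma_pos_of_pos (by positivity)

lemma Gamma_add_le_rpow_mul_Gamma {x s : ℝ} (hx : 0 < x) (hs : s ∈ Set.Icc (0 : ℝ) 1) :
    Real.Gamma (x + s) ≤ x ^ s * Real.Gamma x := by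
  rcases hs.1.eq_or_lt with rfl | hs0
  · simp
  rcases hs.2.eq_or_lt with rfl | hs1
  · rw [Real.Gamma_add_one hx.ne', Real.rpow_one]
  have h := Real.Gamma_mul_add_mul_le_rpow_Gamma_mul_rpow_Gamma hx (by linarith : 0 < x + 1)
    (sub_pos.2 hs1) hs0 (sub_add_cancel 1 s)
  have hΓ := Real.Gamma_pos_of_pos hx
  rw [show (1 - s) * x + s * (x + 1) = x + s by ring, Real.Gamma_add_one hx.ne',
    Real.mul_rpow hx.le hΓ.le, mul_left_comm, ← Real.rpow_add hΓ, sub_add_cancel,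
    Real.rpow_one] at h
  exact h

lemma isShiftSolution_mehtaClosedForm (N : ℕ) {γ : ℝ} (hγ : 0 < γ) :
    IsShiftSolution (mehtaShift N γ) (mehtaClosedForm N γ) where
  nonneg a ha := (mehtaClosedForm_pos N hγ ha).le
  add_one a ha := by
    rw [mehtaShift, mehtaClosedForm, mehtaClosedForm, mul_left_comm, ← prod_mul_distrib]
    congr 1
    refine prod_congr rfl fun k _ => ?_
    rw [add_right_comm, Real.Gamma_add_one (by positivity), Real.rpow_add_one two_ne_zero]
    ring
  add_le a ha s hs := by
    rw [mehtaShift, mehtaClosedForm, mehtaClosedForm, mul_left_comm,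
      ← Real.finsetProd_rpow _ _ fun k _ => by positivity, ← prod_mul_distrib]
    have hΓ : ∀ {x : ℝ}, 0 < x → 0 < Real.Gamma x := Real.Gamma_pos_of_pos
    refine mul_le_mul_of_nonneg_left (prod_le_prod (fun k _ => ?_) fun k _ => ?_) (by positivity)
    · have := hs.1
      have h1 := hΓ (by positivity : 0 < 1 + ((k : ℝ) + 1) * γ)
      have h2 := hΓ (by positivity : 0 < a + s + γ * k)
      have h3 := hΓ (by positivity : 0 < 1 + γ)
      positivity
    · have h1 := hΓ (by positivity : 0 < 1 + ((k : ℝ) + 1) * γ)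
      have h3 := hΓ (by positivity : 0 < 1 + γ)
      have hk : 0 < a + γ * k := by positivity
      have h := Gamma_add_le_rpow_mul_Gamma hk hs
      rw [add_right_comm, Real.rpow_add two_pos, Real.mul_rpow two_pos.le hk.le]
      calc (2 : ℝ) ^ a * 2 ^ s * (Real.Gamma (1 + (k + 1) * γ) * Real.Gamma (a + γ * k + s) /
            Real.Gamma (1 + γ))
          ≤ 2 ^ a * 2 ^ s * (Real.Gamma (1 + (k + 1) * γ) *
            ((a + γ * k) ^ s * Real.Gamma (a + γ * k)) / Real.Gamma (1 + γ)) := by gcongr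
        _ = _ := by ring

lemma mehtaClosedForm_succ_one (n : ℕ) {γ : ℝ} (hγ : 0 < γ) :
    mehtaClosedForm (n + 1) γ 1 = 2 * mehtaClosedForm n γ (1 + 2 * γ) := by
  have hΓ : Real.Gamma (1 + γ) ≠ 0 := (Real.Gamma_pos_of_pos (by positivity)).ne'
  induction n with
  | zero => simp [mehtaClosedForm, hΓ]
  | succ n ih =>
    simp only [mehtaClosedForm] at ih ⊢
    push_cast at ih ⊢
    have e1 : γ * ((n : ℝ) + 1 + 1) * (n + 1 + 1 - 1) =
        γ * ((n : ℝ) + 1) * (n + 1 - 1) + 2 * γ * (n + 1) := by ring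
    have e2 : γ * ((n : ℝ) + 1) * (n + 1 - 1) = γ * n * (n - 1) + 2 * γ * n := by ring
    have e3 : 2 * γ * ((n : ℝ) + 1) = 2 * γ * n + 2 * γ := by ring
    rw [prod_range_succ _ (n + 1), e1, Real.rpow_add two_pos, mul_mul_mul_comm, ih,
      prod_range_succ _ n, e2, e3, Real.rpow_add two_pos (γ * n * (n - 1)),
      Real.rpow_add two_pos (2 * γ * n),
      Real.rpow_add two_pos 1, Real.rpow_one]
    rw [Nat.cast_succ, show 1 + 2 * γ + γ * n = 1 + (n + 1 + 1) * γ by ring,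
      show 1 + γ * ((n : ℝ) + 1) = 1 + (n + 1) * γ by ring]
    ring

lemma mehtaMoment_eq_mehtaClosedForm (N : ℕ) {a γ : ℝ} (ha : 0 < a) (hγ : 0 < γ) :
    mehtaMoment a γ 0 (∅ : Finset (Fin N)) = mehtaClosedForm N γ a := by
  induction N generalizing a with
  | zero => simp [mehtaMoment, mehtaDensity, repulsion, mehtaClosedForm, measureReal_def, volume_pi]
  | succ n ih =>
    have h := (isShiftSolution_mehtaMoment (n + 1) hγ).div_eq_div
      (fun x hx => mehtaShift_pos (n + 1) hγ hx) (tendsto_mehtaShift_div (n + 1) γ)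
      (isShiftSolution_mehtaClosedForm (n + 1) hγ)
      (fun x hx => mehtaClosedForm_pos (n + 1) hγ hx) ha one_pos
    simp only [mehtaMoment_one_empty hγ, mehtaClosedForm_succ_one n hγ] at h
    rw [ih (by positivity), div_self] at h
    · exact (div_eq_one_iff_eq (mehtaClosedForm_pos (n + 1) hγ ha).ne').1 h
    · exact mul_ne_zero two_ne_zero (mehtaClosedForm_pos n hγ (by positivity)).ne'

end ClosedForm

/-- Mehta's integral of the second type:
`∫_{ℝ^N} e^{-|u|²/2} ∏_{i<j} |u_j² - u_i²|^{2γ} ∏_j |u_j|^{2a-1} du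
  = 2^{aN + γN(N-1)} ∏_{j=1}^N Γ(1+jγ)Γ(a+γ(j-1))/Γ(1+γ)`. -/
theorem mehta_integral_second (N : ℕ) (γ a : ℝ) (hγ : 0 < γ) (ha : 0 < a) :
    ∫ u : Fin N → ℝ,
        Real.exp (-(∑ i, u i ^ 2) / 2) *
          (∏ i : Fin N, ∏ j ∈ Finset.Ioi i, |u j ^ 2 - u i ^ 2| ^ (2 * γ)) *
          ∏ j : Fin N, |u j| ^ (2 * a - 1) =
      (2 : ℝ) ^ (a * N + γ * N * (N - 1)) *
        ∏ j ∈ Finset.Icc 1 N,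
          Real.Gamma (1 + j * γ) * Real.Gamma (a + γ * (j - 1)) / Real.Gamma (1 + γ) := by
  have hdensity : ∀ u : Fin N → ℝ, Real.exp (-(∑ i, u i ^ 2) / 2) *
      (∏ i : Fin N, ∏ j ∈ Finset.Ioi i, |u j ^ 2 - u i ^ 2| ^ (2 * γ)) *
      ∏ j : Fin N, |u j| ^ (2 * a - 1) = (∏ j ∈ ∅, u j ^ 2) * mehtaDensity a γ 0 u := fun u => by
    rw [mehtaDensity, repulsion_zero_eq, prod_empty]
    simp only [radialWeight, prod_mul_distrib]
    rw [← Real.exp_sum, ← sum_div, sum_neg_distrib]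
    ring
  have hprod : ∏ j ∈ Finset.Icc 1 N,
      Real.Gamma (1 + j * γ) * Real.Gamma (a + γ * (j - 1)) / Real.Gamma (1 + γ) =
      ∏ k ∈ range N, Real.Gamma (1 + (k + 1) * γ) * Real.Gamma (a + γ * k) /
        Real.Gamma (1 + γ) := by
    rw [range_eq_Ico, ← Ico_add_one_right_eq_Icc, ← prod_Ico_add' _ 0 N 1]
    simp
  simp only [hdensity]
  rw [← mehtaMoment, mehtaMoment_eq_mehtaClosedForm N ha hγ, mehtaClosedForm, prod_mul_distrib,
    prod_const, card_range, ← Real.rpow_mul_natCast two_pos.le, ← mul_assoc,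
    ← Real.rpow_add two_pos, add_comm, hprod]
end
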